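/- arXiv:1404.1042 — 9 statements merged into one kernel-verified Lean document; each statement's English description precedes it below -/
import Mathlib

section
/- Let r ≥ 1 and let (s_1,…,s_r) be positive integers with s_1 ≥ 2 and s_r ≥ 2. Then for every z ∈ ℂ ∖ ℤ the series ∑_{n_1 > n_2 > ⋯ > n_r, n_i ∈ ℤ} ∏_{i=1}^r (n_i + z)^{−s_i} converges absolutely; the resulting function Te^{s_1,…,s_r} is holomorphic on ℂ ∖ ℤ and is 1-periodic, i.e. Te^{s_1,…,s_r}(z+1) = Te^{s_1,…,s_r}(z) for all z ∈ ℂ ∖ ℤ. -/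
/-- Multitangent function: `Te^{s₁,…,s_r}(z) = ∑_{n₁ > n₂ > ⋯ > n_r, nᵢ ∈ ℤ} ∏ (nᵢ + z)^{-sᵢ}`. -/
noncomputable def Te (s : List ℕ) (z : ℂ) : ℂ :=
  ∑' n : {n : Fin s.length → ℤ // StrictAnti n},
    ∏ i : Fin s.length, ((n.1 i : ℂ) + z) ^ (-(s.get i : ℤ))

lemma mt_key {r : ℕ} (a : Fin r → ℝ) (ha : ∀ i, 1 ≤ a i) (t : Fin r → ℕ) (j : Fin r)
    (ht : 1 ≤ t j) (hj : ∀ i, a i ≤ a j) :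
    ∏ i, a i ^ (1 / (r : ℝ)) ≤ ∏ i, a i ^ t i := by
  have hr : (r : ℝ) ≠ 0 := by
    have := j.pos
    positivity
  have h0 : ∀ i, 0 ≤ a i := fun i => zero_le_one.trans (ha i)
  calc ∏ i, a i ^ (1 / (r : ℝ)) ≤ ∏ i : Fin r, a j ^ (1 / (r : ℝ)) := by
        apply Finset.prod_le_prod
        · intro i _
          exact Real.rpow_nonneg (h0 i) _
        · intro i _
          exact Real.rpow_le_rpow (h0 i) (hj i) (by positivity)
    _ = a j := by
        rw [Finset.prod_const, Finset.card_univ, Fintype.card_fin, ← Real.rpow_natCast,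
          ← Real.rpow_mul (h0 j), one_div_mul_cancel hr, Real.rpow_one]
    _ ≤ a j ^ t j := le_self_pow₀ (ha j) (by omega)
    _ = a j ^ t j * 1 := (mul_one _).symm
    _ ≤ a j ^ t j * ∏ i ∈ Finset.univ.erase j, a i ^ t i := by
        apply mul_le_mul_of_nonneg_left _ (pow_nonneg (h0 j) _)
        calc (1 : ℝ) = ∏ i ∈ Finset.univ.erase j, (1 : ℝ) := by simp
          _ ≤ _ := Finset.prod_le_prod (fun _ _ => zero_le_one)
            (fun i _ => one_le_pow₀ (ha i))
    _ = ∏ i, a i ^ t i := Finset.mul_prod_erase _ (fun i => a i ^ t i) (Finset.mem_univ j)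

lemma mt_summable_pi (f : ℤ → ℝ) (h0 : ∀ n, 0 ≤ f n) (hf : Summable f) (r : ℕ) :
    Summable (fun n : Fin r → ℤ => ∏ i, f (n i)) := by
  induction r with
  | zero => exact Summable.of_finite
  | succ r ih =>
    have h := hf.mul_of_nonneg ih h0 (fun n => Finset.prod_nonneg (fun i _ => h0 _))
    rw [← (Fin.consEquiv (fun _ : Fin (r + 1) => ℤ)).summable_iff]
    refine h.congr ?_
    intro x
    simp [Fin.prod_univ_succ, Fin.consEquiv]

lemma mt_summable_g (r : ℕ) (hr : 1 ≤ r) :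
    Summable (fun n : ℤ => ((1 + |(n : ℝ)|) * (1 + |(n : ℝ)|) ^ (1 / (r : ℝ)))⁻¹) := by
  have hs : (1 : ℝ) < 1 + 1 / (r : ℝ) := by
    have : (0 : ℝ) < r := by exact_mod_cast hr
    have : 0 < 1 / (r : ℝ) := by positivity
    linarith
  refine Summable.of_nonneg_of_le (fun n => by positivity) (fun n => ?_)
    ((Real.summable_one_div_int_add_rpow (1 / 2) (1 + 1 / (r : ℝ))).2 hs)
  have hne : (0 : ℝ) < |(n : ℝ) + 1 / 2| := by
    rw [abs_pos]
    intro h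
    have h2 : (2 * n + 1 : ℝ) = 0 := by linarith
    have h3 : (2 * n + 1 : ℤ) = 0 := by exact_mod_cast h2
    omega
  have hle : |(n : ℝ) + 1 / 2| ≤ 1 + |(n : ℝ)| := by
    refine (abs_add_le _ _).trans ?_
    rw [abs_of_pos (by norm_num : (0 : ℝ) < 1 / 2)]
    linarith
  have hp : (0 : ℝ) < 1 + |(n : ℝ)| := by positivity
  have he : (1 + |(n : ℝ)|) * (1 + |(n : ℝ)|) ^ (1 / (r : ℝ))
      = (1 + |(n : ℝ)|) ^ (1 + 1 / (r : ℝ)) := by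
    rw [Real.rpow_add hp, Real.rpow_one]
  rw [he, one_div (|(n : ℝ) + 1 / 2| ^ _)]
  exact inv_anti₀ (Real.rpow_pos_of_pos hne _) (Real.rpow_le_rpow hne.le hle (by positivity))

lemma mt_lower (z₀ : ℂ) (hz : ∀ n : ℤ, z₀ ≠ (n : ℂ)) :
    ∃ δ > 0, ∃ A > 0, ∀ z ∈ Metric.ball z₀ δ, ∀ n : ℤ,
      0 < ‖(n : ℂ) + z‖ ∧ 1 + |(n : ℝ)| ≤ A * ‖(n : ℂ) + z‖ := by
  have ho : IsOpen (Set.range ((↑) : ℤ → ℂ))ᶜ := Complex.isClosed_range_intCast.isOpen_compl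
  have hm : z₀ ∈ (Set.range ((↑) : ℤ → ℂ))ᶜ := by
    rintro ⟨n, hn⟩
    exact hz n hn.symm
  obtain ⟨d, hd, hball⟩ := Metric.isOpen_iff.1 ho z₀ hm
  refine ⟨d / 2, by positivity, 1 + (1 + (‖z₀‖ + d / 2)) / (d / 2), by positivity, ?_⟩
  intro z hzb n
  have h1 : ‖z - z₀‖ < d / 2 := by simpa [dist_eq_norm] using hzb
  have h2 : d ≤ ‖(n : ℂ) + z₀‖ := by
    by_contra hlt
    push Not at hlt
    have hmem : ((-n : ℤ) : ℂ) ∈ Metric.ball z₀ d := by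
      rw [Metric.mem_ball, dist_eq_norm]
      have : ((-n : ℤ) : ℂ) - z₀ = -((n : ℂ) + z₀) := by push_cast; ring
      rw [this, norm_neg]
      exact hlt
    exact hball hmem ⟨-n, rfl⟩
  have h3 : d / 2 ≤ ‖(n : ℂ) + z‖ := by
    have : ‖(n : ℂ) + z₀‖ ≤ ‖(n : ℂ) + z‖ + ‖z - z₀‖ := by
      have e : (n : ℂ) + z₀ = ((n : ℂ) + z) - (z - z₀) := by ring
      rw [e]
      exact norm_sub_le _ _
    linarith
  have h4 : |(n : ℝ)| ≤ ‖(n : ℂ) + z‖ + ‖z‖ := by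
    have e : |(n : ℝ)| = ‖((n : ℂ) + z) - z‖ := by simp
    rw [e]
    exact norm_sub_le _ _
  have h5 : ‖z‖ ≤ ‖z₀‖ + d / 2 := by
    have e : z = z₀ + (z - z₀) := by ring
    have := norm_add_le z₀ (z - z₀)
    rw [← e] at this
    linarith
  refine ⟨by linarith, ?_⟩
  have h6 : (1 + (‖z₀‖ + d / 2)) ≤ (1 + (‖z₀‖ + d / 2)) / (d / 2) * ‖(n : ℂ) + z‖ := by
    rw [div_mul_eq_mul_div, le_div_iff₀ (by positivity)]
    exact mul_le_mul_of_nonneg_left h3 (by positivity)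
  rw [add_mul, one_mul]
  linarith

lemma mt_bound (s : List ℕ) (hr : 1 ≤ s.length) (hpos : ∀ x ∈ s, 0 < x)
    (hfirst : 2 ≤ s.headI) (hlast : 2 ≤ s.getLast!)
    (n : Fin s.length → ℤ) (hn : StrictAnti n) (A : ℝ) (z : ℂ)
    (hz : ∀ n : ℤ, 0 < ‖(n : ℂ) + z‖ ∧ 1 + |(n : ℝ)| ≤ A * ‖(n : ℂ) + z‖) :
    ‖∏ i : Fin s.length, ((n i : ℂ) + z) ^ (-(s.get i : ℤ))‖ ≤
      (∏ i : Fin s.length, A ^ (s.get i)) *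
      ∏ i : Fin s.length, ((1 + |(n i : ℝ)|) * (1 + |(n i : ℝ)|) ^ (1 / (s.length : ℝ)))⁻¹ := by
  have hs : ∀ i : Fin s.length, 1 ≤ s.get i := fun i => hpos _ (List.get_mem s i)
  have hf : 2 ≤ s.get ⟨0, hr⟩ := by
    cases s with
    | nil => simp at hr
    | cons a l => simpa using hfirst
  have hl : 2 ≤ s.get ⟨s.length - 1, by omega⟩ := by
    rw [List.getLast!_eq_getElem!, getElem!_pos s (s.length - 1) (by omega)] at hlast
    simpa using hlast
  have hM : ∃ j : Fin s.length, 1 ≤ s.get j - 1 ∧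
      ∀ i, 1 + |(n i : ℝ)| ≤ 1 + |(n j : ℝ)| := by
    have hab : ∀ i, |n i| ≤ max |n ⟨0, hr⟩| |n ⟨s.length - 1, by omega⟩| := by
      intro i
      have u1 : n i ≤ n ⟨0, hr⟩ := hn.antitone (Fin.mk_le_of_le_val (Nat.zero_le _))
      have u2 : n ⟨s.length - 1, by omega⟩ ≤ n i :=
        hn.antitone (Fin.le_def.2 (by simp; omega))
      rcases le_total 0 (n i) with h | h
      · exact le_max_of_le_left (abs_le_abs u1 (by omega))
      · exact le_max_of_le_right (by rw [abs_of_nonpos h, abs_of_nonpos (u2.trans h)]; omega)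
    rcases le_total |n ⟨0, hr⟩| |n ⟨s.length - 1, by omega⟩| with h | h
    · refine ⟨⟨s.length - 1, by omega⟩, by omega, fun i => ?_⟩
      have := hab i
      rw [max_eq_right h] at this
      have h' : (|(n i : ℝ)|) ≤ |(n ⟨s.length - 1, by omega⟩ : ℝ)| := by exact_mod_cast this
      linarith
    · refine ⟨⟨0, hr⟩, by omega, fun i => ?_⟩
      have := hab i
      rw [max_eq_left h] at this
      have h' : (|(n i : ℝ)|) ≤ |(n ⟨0, hr⟩ : ℝ)| := by exact_mod_cast this
      linarith
  obtain ⟨j, hj1, hj2⟩ := hM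
  have key := mt_key (fun i => 1 + |(n i : ℝ)|) (fun i => by simp) (fun i => s.get i - 1) j
    hj1 hj2
  have h1 : ∏ i : Fin s.length, ((1 + |(n i : ℝ)|) * (1 + |(n i : ℝ)|) ^ (1 / (s.length : ℝ)))
      ≤ ∏ i : Fin s.length, (1 + |(n i : ℝ)|) ^ s.get i := by
    have e : ∏ i : Fin s.length, (1 + |(n i : ℝ)|) ^ s.get i =
        (∏ i : Fin s.length, (1 + |(n i : ℝ)|)) *
          ∏ i : Fin s.length, (1 + |(n i : ℝ)|) ^ (s.get i - 1) := by
      rw [← Finset.prod_mul_distrib]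
      refine Finset.prod_congr rfl (fun i _ => ?_)
      rw [← pow_succ', Nat.sub_add_cancel (hs i)]
    rw [e, Finset.prod_mul_distrib]
    exact mul_le_mul_of_nonneg_left key (by positivity)
  have h2 : ∏ i : Fin s.length, (1 + |(n i : ℝ)|) ^ s.get i ≤
      (∏ i : Fin s.length, A ^ (s.get i)) * ∏ i : Fin s.length, ‖(n i : ℂ) + z‖ ^ s.get i := by
    rw [← Finset.prod_mul_distrib]
    refine Finset.prod_le_prod (fun i _ => by positivity) (fun i _ => ?_)
    rw [← mul_pow]
    exact pow_le_pow_left₀ (by positivity) (hz (n i)).2 _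
  have h3 : ‖∏ i : Fin s.length, ((n i : ℂ) + z) ^ (-(s.get i : ℤ))‖
      = (∏ i : Fin s.length, ‖(n i : ℂ) + z‖ ^ s.get i)⁻¹ := by
    rw [norm_prod, ← Finset.prod_inv_distrib]
    refine Finset.prod_congr rfl (fun i _ => ?_)
    rw [zpow_neg, norm_inv, zpow_natCast, norm_pow]
  have hp1 : 0 < ∏ i : Fin s.length, ‖(n i : ℂ) + z‖ ^ s.get i :=
    Finset.prod_pos (fun i _ => pow_pos (hz (n i)).1 _)
  have hp2 : 0 < ∏ i : Fin s.length,
      ((1 + |(n i : ℝ)|) * (1 + |(n i : ℝ)|) ^ (1 / (s.length : ℝ))) :=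
    Finset.prod_pos (fun i _ => by positivity)
  rw [h3, Finset.prod_inv_distrib, ← div_eq_mul_inv, le_div_iff₀ hp2, inv_mul_le_iff₀ hp1,
    mul_comm (∏ i : Fin s.length, ‖(n i : ℂ) + z‖ ^ s.get i)]
  exact h1.trans h2

def mtShift (r : ℕ) : {n : Fin r → ℤ // StrictAnti n} ≃ {n : Fin r → ℤ // StrictAnti n} where
  toFun n := ⟨fun i => n.1 i + 1, fun _ _ h => by simpa using n.2 h⟩
  invFun n := ⟨fun i => n.1 i - 1, fun _ _ h => by simpa using n.2 h⟩
  left_inv n := by ext; simp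
  right_inv n := by ext; simp

theorem multitangent_summable_holomorphic_periodic
    (s : List ℕ) (hr : 1 ≤ s.length) (hpos : ∀ x ∈ s, 0 < x)
    (hfirst : 2 ≤ s.headI) (hlast : 2 ≤ s.getLast!) :
    (∀ z : ℂ, (∀ n : ℤ, z ≠ (n : ℂ)) →
      Summable (fun n : {n : Fin s.length → ℤ // StrictAnti n} =>
        ‖∏ i : Fin s.length, ((n.1 i : ℂ) + z) ^ (-(s.get i : ℤ))‖)) ∧
    DifferentiableOn ℂ (Te s) {z : ℂ | ∀ n : ℤ, z ≠ (n : ℂ)} ∧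
    (∀ z : ℂ, (∀ n : ℤ, z ≠ (n : ℂ)) → Te s (z + 1) = Te s z) := by
  have hsum := (mt_summable_pi _ (fun n => by positivity) (mt_summable_g s.length hr)
    s.length).subtype {n : Fin s.length → ℤ | StrictAnti n}
  refine ⟨fun z hz => ?_, fun z hz => ?_, fun z _ => ?_⟩
  · obtain ⟨δ, hδ, A, hA, h⟩ := mt_lower z hz
    refine Summable.of_nonneg_of_le (fun _ => norm_nonneg _) (fun n => ?_)
      (hsum.mul_left (∏ i : Fin s.length, A ^ (s.get i)))
    exact mt_bound s hr hpos hfirst hlast n.1 n.2 A z (h z (Metric.mem_ball_self hδ))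
  · obtain ⟨δ, hδ, A, hA, h⟩ := mt_lower z hz
    have hd : DifferentiableOn ℂ (Te s) (Metric.ball z δ) := by
      refine Complex.differentiableOn_tsum_of_summable_norm
        (hsum.mul_left (∏ i : Fin s.length, A ^ (s.get i))) (fun n => ?_) Metric.isOpen_ball
        (fun n w hw => mt_bound s hr hpos hfirst hlast n.1 n.2 A w (h w hw))
      refine DifferentiableOn.fun_finsetProd (fun i _ => ?_)
      intro w hw
      have hne : (n.1 i : ℂ) + w ≠ 0 := norm_pos_iff.1 (h w hw (n.1 i)).1
      exact ((differentiableAt_id.const_add _).zpow (Or.inl hne)).differentiableWithinAt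
    exact (hd.differentiableAt (Metric.ball_mem_nhds z hδ)).differentiableWithinAt
  · unfold Te
    rw [← (mtShift s.length).tsum_eq (fun n => ∏ i : Fin s.length, ((n.1 i : ℂ) + z) ^ (-(s.get i : ℤ)))]
    refine tsum_congr (fun n => Finset.prod_congr rfl (fun i _ => ?_))
    simp only [mtShift, Equiv.coe_fn_mk]
    push_cast
    congr 1
    ring
end

section
/- Multitangents are symmetrel: let s′ = (s′_1,…,s′_p) and s″ = (s″_1,…,s″_q) be nonempty sequences of positive integers with s′_1, s′_p, s″_1, s″_q all ≥ 2. Then for every z ∈ ℂ ∖ ℤ one has Te^{s′}(z) · Te^{s″}(z) = ∑_{w ∈ she(s′,s″)} Te^{w}(z), the sum (with multiplicity) running over the multiset she(s′,s″) of contracting shuffles of s′ and s″. -/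
/-- The multiset of contracting shuffles of two sequences: interleavings of the two sequences
(preserving internal orders), with optional merging (sum) of adjacent pairs coming from the two
different sequences. -/
def she : List ℕ → List ℕ → Multiset (List ℕ)
  | [], t => {t}
  | a :: s, [] => {a :: s}
  | a :: s, b :: t =>
      ((she s (b :: t)).map (a :: ·)) + ((she (a :: s) t).map (b :: ·))
        + ((she s t).map ((a + b) :: ·))
termination_by s t => s.length + t.length

namespace MT

noncomputable def F (z : ℂ) (n : ℤ) (x : ℕ) : ℂ := ((n : ℂ) + z) ^ (-(x : ℤ))

lemma F_add (z : ℂ) (n : ℤ) (x y : ℕ) : F z n (x + y) = F z n x * F z n y := by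
  simp only [F, zpow_neg, zpow_natCast, pow_add, mul_inv]

noncomputable def T (z : ℂ) (a : ℤ) : List ℕ → ℕ → ℂ
  | [], _ => 1
  | x :: s, k => ∑ j ∈ Finset.range k, F z (a + j) x * T z a s j

lemma T_succ (z : ℂ) (a : ℤ) (x : ℕ) (s : List ℕ) (k : ℕ) :
    T z a (x :: s) (k + 1) = T z a (x :: s) k + F z (a + k) x * T z a s k := by
  simp only [T, Finset.sum_range_succ]

lemma T_zero (z : ℂ) (a : ℤ) (x : ℕ) (s : List ℕ) : T z a (x :: s) 0 = 0 := by
  simp [T]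

lemma T_mul (z : ℂ) (a : ℤ) (k : ℕ) : ∀ s t : List ℕ,
    T z a s k * T z a t k = ((she s t).map (fun w => T z a w k)).sum := by
  induction k with
  | zero =>
    intro s t
    cases s with
    | nil => simp [she, T]
    | cons x s =>
      cases t with
      | nil => simp [she, T]
      | cons y t => simp [she, T_zero, Multiset.map_map, Function.comp_def]
  | succ k ih =>
    intro s t
    cases s with
    | nil => simp [she, T]
    | cons x s =>
      cases t with
      | nil => simp [she, T]
      | cons y t =>
        have h := ih (x :: s) (y :: t)
        simp only [she, Multiset.map_add, Multiset.sum_add, Multiset.map_map, Function.comp_def,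
          T_succ, Multiset.sum_map_add, Multiset.sum_map_mul_left, F_add] at h ⊢
        rw [← ih s (y :: t), ← ih (x :: s) t, ← ih s t]
        linear_combination h

open Classical in
noncomputable def A (a : ℤ) (k m : ℕ) : Finset (Fin m → ℤ) :=
  (Fintype.piFinset (fun _ : Fin m => Finset.Ico a (a + k))).filter StrictAnti

lemma mem_A (a : ℤ) (k m : ℕ) (n : Fin m → ℤ) :
    n ∈ A a k m ↔ (∀ i, a ≤ n i ∧ n i < a + k) ∧ StrictAnti n := by
  simp [A]

lemma sum_A (a : ℤ) (k m : ℕ) (g : (Fin (m + 1) → ℤ) → ℂ) :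
    ∑ n ∈ A a k (m + 1), g n =
      ∑ j ∈ Finset.range k, ∑ n ∈ A a j m, g (Fin.cons (a + j) n) := by
  rw [Finset.sum_sigma']
  refine Finset.sum_bij' (fun n _ => (⟨(n 0 - a).toNat, Fin.tail n⟩ : (_ : ℕ) × (Fin m → ℤ)))
    (fun p _ => Fin.cons (a + p.1) p.2) ?_ ?_ ?_ ?_ ?_
  · intro n hn
    rw [mem_A] at hn
    obtain ⟨h1, h2⟩ := hn
    have h0 := h1 0
    simp only [Finset.mem_sigma, Finset.mem_range, mem_A]
    refine ⟨by omega, fun i => ⟨(h1 _).1, ?_⟩, fun i j hij => h2 (Fin.succ_lt_succ_iff.2 hij)⟩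
    have : n i.succ < n 0 := h2 (Fin.succ_pos i)
    simp only [Fin.tail]
    omega
  · rintro ⟨j, n⟩ hn
    simp only [Finset.mem_sigma, Finset.mem_range, mem_A] at hn
    obtain ⟨hj, h1, h2⟩ := hn
    rw [mem_A]
    constructor
    · intro i
      refine Fin.cases ?_ (fun i => ?_) i
      · simp; omega
      · have := h1 i
        simp only [Fin.cons_succ]; omega
    · intro i i'
      refine Fin.cases ?_ (fun i => ?_) i <;> refine Fin.cases ?_ (fun i' => ?_) i'
      · simp
      · intro _; have := h1 i'
        simp only [Fin.cons_succ, Fin.cons_zero]; omega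
      · simp
      · intro h
        simp only [Fin.cons_succ]
        exact h2 (Fin.succ_lt_succ_iff.1 h)
  · intro n hn
    rw [mem_A] at hn
    have h0 := hn.1 0
    have : a + ((n 0 - a).toNat : ℤ) = n 0 := by omega
    simp only [this, Fin.cons_self_tail]
  · rintro ⟨j, n⟩ hn
    simp
  · intro n hn
    rw [mem_A] at hn
    have h0 := hn.1 0
    have : a + ((n 0 - a).toNat : ℤ) = n 0 := by omega
    simp only [this, Fin.cons_self_tail]

lemma T_eq (z : ℂ) (a : ℤ) : ∀ (s : List ℕ) (k : ℕ),
    T z a s k = ∑ n ∈ A a k s.length, ∏ i : Fin s.length, F z (n i) (s.get i)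
  | [], k => by
    have : A a k ([] : List ℕ).length = {fun i => i.elim0} := by
      ext n
      simp only [mem_A, Finset.mem_singleton]
      constructor
      · intro _; funext i; exact i.elim0
      · intro _; exact ⟨fun i => i.elim0, fun i => i.elim0⟩
    rw [this]
    simp [T]
  | x :: s, k => by
    simp only [List.length_cons]
    rw [sum_A]
    simp only [T]
    refine Finset.sum_congr rfl fun j _ => ?_
    rw [T_eq z a s j, Finset.mul_sum]
    refine Finset.sum_congr rfl fun n _ => ?_
    rw [Fin.prod_univ_succ]
    simp

/-- good sequences -/
def Good (s : List ℕ) : Prop := (∀ x ∈ s, 0 < x) ∧ (∀ x ∈ s.head?, 2 ≤ x) ∧ (∀ x ∈ s.getLast?, 2 ≤ x)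

lemma she_last : ∀ s t : List ℕ, (∀ x ∈ s, 0 < x) → (∀ x ∈ s.getLast?, 2 ≤ x) →
    (∀ x ∈ t, 0 < x) → (∀ x ∈ t.getLast?, 2 ≤ x) → ∀ w ∈ she s t,
    (∀ x ∈ w, 0 < x) ∧ (∀ x ∈ w.getLast?, 2 ≤ x) ∧ (w = [] → s = [] ∧ t = [])
  | [], t => by
    intro _ _ h1 h2 w hw
    simp only [she, Multiset.mem_singleton] at hw
    subst hw
    exact ⟨h1, h2, fun h => ⟨rfl, h⟩⟩
  | x :: s, [] => by
    intro h1 h2 _ _ w hw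
    simp only [she, Multiset.mem_singleton] at hw
    subst hw
    exact ⟨h1, h2, by simp⟩
  | x :: s, y :: t => by
    intro h1 h2 h3 h4 w hw
    have hs : ∀ x ∈ s.getLast?, 2 ≤ x := by
      intro u hu; apply h2; cases s <;> simp_all
    have ht : ∀ x ∈ t.getLast?, 2 ≤ x := by
      intro u hu; apply h4; cases t <;> simp_all
    have hs' : ∀ x ∈ s, 0 < x := fun u hu => h1 u (by simp [hu])
    have ht' : ∀ x ∈ t, 0 < x := fun u hu => h3 u (by simp [hu])
    have hx := h1 x (by simp)
    have hy := h3 y (by simp)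
    simp only [she, Multiset.mem_add, Multiset.mem_map] at hw
    rcases hw with (⟨w, hw, rfl⟩ | ⟨w, hw, rfl⟩) | ⟨w, hw, rfl⟩
    · obtain ⟨a1, a2, a3⟩ := she_last s (y :: t) hs' hs h3 h4 w hw
      refine ⟨by simpa using ⟨hx, a1⟩, ?_, by simp⟩
      cases w with
      | nil => simp at a3
      | cons c w => simpa using a2
    · obtain ⟨a1, a2, a3⟩ := she_last (x :: s) t h1 h2 ht' ht w hw
      refine ⟨by simpa using ⟨hy, a1⟩, ?_, by simp⟩
      cases w with
      | nil => simp at a3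
      | cons c w => simpa using a2
    · obtain ⟨a1, a2, a3⟩ := she_last s t hs' hs ht' ht w hw
      refine ⟨by simpa using ⟨Or.inl hx, a1⟩, ?_, by simp⟩
      cases w with
      | nil => simp; omega
      | cons c w => simpa using a2
termination_by s t => s.length + t.length

lemma she_good (s t : List ℕ) (hs : Good s) (ht : Good t) (hs0 : s ≠ []) (ht0 : t ≠ []) :
    ∀ w ∈ she s t, w ≠ [] ∧ Good w := by
  intro w hw
  obtain ⟨a1, a2, a3⟩ := she_last s t hs.1 hs.2.2 ht.1 ht.2.2 w hw
  refine ⟨fun h => hs0 (a3 h).1, a1, ?_, a2⟩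
  cases s with
  | nil => simp at hs0
  | cons x s =>
    cases t with
    | nil => simp at ht0
    | cons y t =>
      have h1 := hs.2.1 x (by simp)
      have h2 := ht.2.1 y (by simp)
      simp only [she, Multiset.mem_add, Multiset.mem_map] at hw
      rcases hw with (⟨w, hw, rfl⟩ | ⟨w, hw, rfl⟩) | ⟨w, hw, rfl⟩ <;> simp <;> omega

lemma summable_pi (m : ℕ) (g : ℤ → ℝ) (hg : ∀ n, 0 ≤ g n) (h : Summable g) :
    Summable (fun n : Fin m → ℤ => ∏ i, g (n i)) := by
  classical
  refine summable_of_sum_le (c := ∏ _i : Fin m, ∑' n, g n)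
    (fun n => Finset.prod_nonneg fun i _ => hg _) (fun u => ?_)
  calc ∑ n ∈ u, ∏ i, g (n i)
      ≤ ∑ n ∈ Fintype.piFinset (fun i => u.image (fun n => n i)), ∏ i, g (n i) := by
        refine Finset.sum_le_sum_of_subset_of_nonneg ?_ 
          (fun n _ _ => Finset.prod_nonneg fun i _ => hg _)
        intro n hn
        rw [Fintype.mem_piFinset]
        intro i
        exact Finset.mem_image_of_mem _ hn
    _ = ∏ i, ∑ n ∈ u.image (fun n => n i), g n := by
        rw [Finset.prod_univ_sum]
    _ ≤ _ := by
        refine Finset.prod_le_prod (fun i _ => Finset.sum_nonneg fun n _ => hg n) fun i _ => ?_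
        exact h.sum_le_tsum _ (fun n _ => hg n)

lemma summable_v (b : ℝ) (hb : 1 < b) : Summable (fun n : ℤ => (1 + |(n : ℝ)|) ^ (-b)) := by
  have h : Summable (fun n : ℕ => (1 + (n : ℝ)) ^ (-b)) := by
    have := (summable_nat_add_iff 1).2 (Real.summable_nat_rpow.2 (neg_lt_neg hb))
    refine this.congr fun n => ?_
    push_cast; rw [add_comm]
  refine Summable.of_nat_of_neg ?_ ?_ <;> simpa using h

lemma bound (z : ℂ) (hz : ∀ n : ℤ, z ≠ (n : ℂ)) :
    ∃ C : ℝ, 0 < C ∧ ∀ n : ℤ, ‖(n : ℂ) + z‖⁻¹ ≤ C * (1 + |(n : ℝ)|)⁻¹ := by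
  have ho := Complex.isOpen_compl_range_intCast
  have hmem : z ∈ (Set.range ((↑) : ℤ → ℂ))ᶜ := by
    rintro ⟨n, hn⟩; exact hz n hn.symm
  obtain ⟨δ, hδ, hball⟩ := Metric.isOpen_iff.1 ho z hmem
  have hd : ∀ n : ℤ, δ ≤ ‖(n : ℂ) + z‖ := by
    intro n
    by_contra hlt
    push Not at hlt
    refine hball (a := ((-n : ℤ) : ℂ)) ?_ ⟨-n, rfl⟩
    rw [Metric.mem_ball, dist_comm, dist_eq_norm]
    simpa [add_comm] using hlt
  refine ⟨1 + (1 + ‖z‖) / δ, by positivity, fun n => ?_⟩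
  have h1 := hd n
  have hp : 0 < ‖(n : ℂ) + z‖ := lt_of_lt_of_le hδ h1
  have hv : 0 < 1 + |(n : ℝ)| := by positivity
  have h2 : |(n : ℝ)| ≤ ‖(n : ℂ) + z‖ + ‖z‖ := by
    have := norm_sub_le ((n : ℂ) + z) z
    simpa using this
  rw [← div_eq_mul_inv, le_div_iff₀ hv, inv_mul_le_iff₀ hp]
  have h3 : (1 + ‖z‖) ≤ ‖(n : ℂ) + z‖ * ((1 + ‖z‖) / δ) := by
    rw [mul_div_assoc', le_div_iff₀ hδ, mul_comm]
    gcongr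
  linarith

lemma prod_bound (m : ℕ) (s : Fin m → ℕ) (v : Fin m → ℝ) (hs : ∀ i, 1 ≤ s i) (hv : ∀ i, 1 ≤ v i)
    (p : Fin m) (hp : 2 ≤ s p) (hmax : ∀ i, v i ≤ v p) :
    ∏ i, (v i)⁻¹ ^ s i ≤ ∏ i, v i ^ (-(1 + 1 / (m : ℝ))) := by
  have hm : (0 : ℝ) < m := by exact_mod_cast p.pos
  have hv0 : ∀ i, 0 < v i := fun i => lt_of_lt_of_le one_pos (hv i)
  have key : ∏ i, v i ^ (1 / (m : ℝ)) ≤ ∏ i, v i ^ (s i - 1) := by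
    calc ∏ i, v i ^ (1 / (m : ℝ)) ≤ ∏ _i : Fin m, v p ^ (1 / (m : ℝ)) :=
          Finset.prod_le_prod (fun i _ => (Real.rpow_pos_of_pos (hv0 i) _).le)
            fun i _ => Real.rpow_le_rpow (hv0 i).le (hmax i) (by positivity)
      _ = v p := by
          rw [Finset.prod_const, Finset.card_univ, Fintype.card_fin, ← Real.rpow_natCast,
            ← Real.rpow_mul (hv0 p).le, one_div_mul_cancel hm.ne', Real.rpow_one]
      _ ≤ v p ^ (s p - 1) := le_self_pow₀ (hv p) (by omega)
      _ ≤ ∏ i, v i ^ (s i - 1) := by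
          rw [← Finset.mul_prod_erase _ _ (Finset.mem_univ p)]
          refine le_mul_of_one_le_right (pow_pos (hv0 p) _).le ?_
          calc (1 : ℝ) = ∏ _i ∈ Finset.univ.erase p, (1 : ℝ) := by simp
            _ ≤ _ := Finset.prod_le_prod (fun _ _ => zero_le_one) fun i _ => one_le_pow₀ (hv i)
  have e1 : ∏ i, (v i)⁻¹ ^ s i = (∏ i, (v i)⁻¹) * (∏ i, v i ^ (s i - 1))⁻¹ := by
    rw [← Finset.prod_inv_distrib, ← Finset.prod_mul_distrib]
    refine Finset.prod_congr rfl fun i _ => ?_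
    rw [← inv_pow, ← pow_succ', Nat.sub_add_cancel (hs i)]
  have e2 : ∏ i, v i ^ (-(1 + 1 / (m : ℝ))) = (∏ i, (v i)⁻¹) * (∏ i, v i ^ (1 / (m : ℝ)))⁻¹ := by
    rw [← Finset.prod_inv_distrib, ← Finset.prod_mul_distrib]
    refine Finset.prod_congr rfl fun i _ => ?_
    rw [Real.rpow_neg (hv0 i).le, Real.rpow_add (hv0 i), Real.rpow_one, mul_inv]
  rw [e1, e2]
  refine mul_le_mul_of_nonneg_left ?_ (Finset.prod_nonneg fun i _ => (inv_pos.2 (hv0 i)).le)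
  exact inv_anti₀ (Finset.prod_pos fun i _ => Real.rpow_pos_of_pos (hv0 i) _) key

lemma summable_Te (s : List ℕ) (h0 : s ≠ []) (hs : Good s) (z : ℂ) (hz : ∀ n : ℤ, z ≠ (n : ℂ)) :
    Summable (fun n : {n : Fin s.length → ℤ // StrictAnti n} =>
      ∏ i : Fin s.length, F z (n.1 i) (s.get i)) := by
  obtain ⟨C, hC, hb⟩ := bound z hz
  have hl : 0 < s.length := List.length_pos_iff.2 h0
  have hS := summable_pi s.length _ (fun n => by positivity)
    (summable_v (1 + 1 / (s.length : ℝ)) (by simp; exact hl))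
  have hS2 := ((hS.mul_left (∏ i, C ^ s.get i)).comp_injective
    (Subtype.val_injective (p := fun n : Fin s.length → ℤ => StrictAnti n)))
  refine Summable.of_norm_bounded hS2 ?_
  rintro ⟨n, hn⟩
  simp only [Function.comp_def, norm_prod]
  have hfirst : 2 ≤ s.get ⟨0, hl⟩ := by
    apply hs.2.1
    simp [List.head?_eq_getElem?, hl]
  have hlast : 2 ≤ s.get ⟨s.length - 1, by omega⟩ := by
    apply hs.2.2
    simp [List.getLast?_eq_getElem?, hl]
  have hex : ∃ p : Fin s.length, 2 ≤ s.get p ∧ ∀ i, 1 + |(n i : ℝ)| ≤ 1 + |(n p : ℝ)| := by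
    have ha : ∀ i, n i ≤ n ⟨0, hl⟩ := fun i => hn.antitone (Fin.mk_le_of_le_val (Nat.zero_le _))
    have hc : ∀ i, n ⟨s.length - 1, by omega⟩ ≤ n i := fun i =>
      hn.antitone (by rw [Fin.le_def]; simp; omega)
    rcases le_total |n ⟨0, hl⟩| |n ⟨s.length - 1, by omega⟩| with h | h
    · refine ⟨_, hlast, fun i => ?_⟩
      have : |n i| ≤ |n ⟨s.length - 1, by omega⟩| := by
        have := ha i; have := hc i
        grind
      have : ((|n i| : ℤ) : ℝ) ≤ (|n ⟨s.length - 1, by omega⟩| : ℤ) := by exact_mod_cast this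
      push_cast at this
      linarith
    · refine ⟨_, hfirst, fun i => ?_⟩
      have : |n i| ≤ |n ⟨0, hl⟩| := by
        have := ha i; have := hc i
        grind
      have : ((|n i| : ℤ) : ℝ) ≤ (|n ⟨0, hl⟩| : ℤ) := by exact_mod_cast this
      push_cast at this
      linarith
  obtain ⟨p, hp, hmax⟩ := hex
  have hpb := prod_bound s.length s.get (fun i => 1 + |(n i : ℝ)|)
    (fun i => hs.1 _ (List.get_mem _ _)) (fun i => by simp) p hp hmax
  calc ∏ i, ‖F z (n i) (s.get i)‖ ≤ ∏ i, (C ^ s.get i * (1 + |(n i : ℝ)|)⁻¹ ^ s.get i) := by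
        refine Finset.prod_le_prod (fun i _ => norm_nonneg _) fun i _ => ?_
        rw [← mul_pow, F, zpow_neg, zpow_natCast, ← inv_pow, norm_pow, norm_inv]
        exact pow_le_pow_left₀ (by positivity) (hb _) _
    _ ≤ _ := by
        rw [Finset.prod_mul_distrib]
        exact mul_le_mul_of_nonneg_left hpb (Finset.prod_nonneg fun i _ => by positivity)

open Filter Topology in
lemma T_tendsto (s : List ℕ) (h0 : s ≠ []) (hs : Good s) (z : ℂ) (hz : ∀ n : ℤ, z ≠ (n : ℂ)) :
    Tendsto (fun N : ℕ => T z (-(N : ℤ)) s (2 * N)) atTop (𝓝 (Te s z)) := by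
  classical
  have h := (summable_Te s h0 hs z hz).hasSum
  have h' : Tendsto (fun N : ℕ => (A (-(N : ℤ)) (2 * N) s.length).subtype
      (fun n : Fin s.length → ℤ => StrictAnti n)) atTop atTop := by
    refine tendsto_atTop_finset_of_monotone ?_ ?_
    · intro N M hNM n hn
      rw [Finset.mem_subtype, mem_A] at hn ⊢
      refine ⟨fun i => ?_, hn.2⟩
      have := hn.1 i
      push_cast at this ⊢
      omega
    · intro n
      refine ⟨∑ i, (n.1 i).natAbs + 1, ?_⟩
      rw [Finset.mem_subtype, mem_A]
      refine ⟨fun i => ?_, n.2⟩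
      have := Finset.single_le_sum (f := fun i => (n.1 i).natAbs) (fun _ _ => Nat.zero_le _)
        (Finset.mem_univ i)
      rw [Nat.cast_mul, Nat.cast_add]
      omega
  refine (h.comp h').congr fun N => ?_
  simp only [Function.comp_def]
  rw [T_eq, Finset.sum_subtype_of_mem (f := fun n : Fin s.length → ℤ => ∏ i, F z (n i) (s.get i))]
  intro n hn
  exact ((mem_A _ _ _ _).1 hn).2

end MT

theorem multitangent_symmetrel
    (s' s'' : List ℕ) (h' : s' ≠ []) (h'' : s'' ≠ [])
    (hpos' : ∀ x ∈ s', 0 < x) (hpos'' : ∀ x ∈ s'', 0 < x)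
    (hfirst' : 2 ≤ s'.headI) (hlast' : 2 ≤ s'.getLast!)
    (hfirst'' : 2 ≤ s''.headI) (hlast'' : 2 ≤ s''.getLast!)
    (z : ℂ) (hz : ∀ n : ℤ, z ≠ (n : ℂ)) :
    Te s' z * Te s'' z = ((she s' s'').map (fun w => Te w z)).sum := by
  have mk : ∀ s : List ℕ, s ≠ [] → (∀ x ∈ s, 0 < x) → 2 ≤ s.headI → 2 ≤ s.getLast! →
      MT.Good s := by
    intro s h0 h1 h2 h3
    refine ⟨h1, ?_, ?_⟩
    · cases s <;> simp_all
    · intro x hx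
      rw [List.getLast!_eq_getLast?_getD] at h3
      rw [Option.mem_def] at hx
      simpa [hx] using h3
  have g' := mk s' h' hpos' hfirst' hlast'
  have g'' := mk s'' h'' hpos'' hfirst'' hlast''
  have L1 := (MT.T_tendsto s' h' g' z hz).mul (MT.T_tendsto s'' h'' g'' z hz)
  have L2 := tendsto_multiset_sum (f := fun (w : List ℕ) (N : ℕ) => MT.T z (-(N : ℤ)) w (2 * N))
    (a := fun w => Te w z) (x := Filter.atTop) (she s' s'')
    (fun w hw => MT.T_tendsto w (MT.she_good s' s'' g' g'' h' h'' w hw).1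
      (MT.she_good s' s'' g' g'' h' h'' w hw).2 z hz)
  refine tendsto_nhds_unique L1 (L2.congr fun N => ?_)
  rw [MT.T_mul]
end

section
/- Multizetas are symmetrel: let s′ = (s′_1,…,s′_p) and s″ = (s″_1,…,s″_q) be nonempty sequences of positive integers with s′_1 ≥ 2 and s″_1 ≥ 2. Then Ze^{s′} · Ze^{s″} = ∑_{w ∈ she(s′,s″)} Ze^{w}, the sum (with multiplicity) running over the multiset she(s′,s″) of contracting shuffles of s′ and s″. -/
/-- Multizeta value: `Ze^{s₁,…,s_r} = ∑_{n₁ > n₂ > ⋯ > n_r > 0} ∏ nᵢ^{-sᵢ}`; `Ze^{∅} = 1`. -/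
noncomputable def Ze (s : List ℕ) : ℝ :=
  ∑' n : {n : Fin s.length → ℕ // StrictAnti n ∧ ∀ i, 0 < n i},
    ∏ i : Fin s.length, ((n.1 i : ℝ)) ^ (-(s.get i : ℤ))

/-- Truncated multizeta. -/
noncomputable def TZ : ℕ → List ℕ → ℝ
  | _, [] => 1
  | 0, _ :: _ => 0
  | N + 1, a :: s => TZ N (a :: s) + ((N + 1 : ℕ) : ℝ) ^ (-(a : ℤ)) * TZ N s

theorem TZ_nil (N : ℕ) : TZ N [] = 1 := by cases N <;> simp [TZ]

theorem TZ_nonneg (N : ℕ) : ∀ s, 0 ≤ TZ N s := by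
  induction N with
  | zero => intro s; cases s <;> simp [TZ]
  | succ N ih =>
    intro s
    cases s with
    | nil => simp [TZ]
    | cons a s =>
      rw [TZ]
      have := ih (a :: s)
      have := ih s
      positivity

theorem TZ_mul (N : ℕ) : ∀ s t, TZ N s * TZ N t = ((she s t).map (TZ N)).sum := by
  induction N with
  | zero =>
    intro s t
    cases s with
    | nil => simp [she, TZ]
    | cons a s =>
      cases t with
      | nil => simp [she, TZ]
      | cons b t => simp [she, TZ, Function.comp_def]
  | succ N ih =>
    intro s t
    cases s with
    | nil => simp [she, TZ]
    | cons a s =>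
      cases t with
      | nil => simp [she, TZ]
      | cons b t =>
        have h1 := ih (a :: s) (b :: t)
        have h2 := ih s (b :: t)
        have h3 := ih (a :: s) t
        have h4 := ih s t
        have hx : ((N + 1 : ℕ) : ℝ) ≠ 0 := by positivity
        rw [she]
        rw [she] at h1
        simp only [Multiset.map_add, Multiset.map_map, Function.comp_def, Multiset.sum_add, TZ,
          Multiset.sum_map_add, Multiset.sum_map_mul_left] at h1 ⊢
        rw [← h2, ← h3, ← h4]
        have hz : ((N + 1 : ℕ) : ℝ) ^ (-((a + b : ℕ) : ℤ)) =
            ((N + 1 : ℕ) : ℝ) ^ (-(a : ℤ)) * ((N + 1 : ℕ) : ℝ) ^ (-(b : ℤ)) := by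
          rw [← zpow_add₀ hx]; congr 1; push_cast; ring
        rw [hz]
        linear_combination h1

theorem TZ_cons_sum (a : ℕ) (s : List ℕ) (N : ℕ) :
    TZ N (a :: s) = ∑ k ∈ Finset.range N, ((k + 1 : ℕ) : ℝ) ^ (-(a : ℤ)) * TZ k s := by
  induction N with
  | zero => simp [TZ]
  | succ N ih => rw [TZ, Finset.sum_range_succ, ih]

theorem TZ_mono (s : List ℕ) : Monotone fun N => TZ N s := by
  apply monotone_nat_of_le_succ
  intro N
  cases s with
  | nil => simp [TZ_nil]
  | cons a s =>
    rw [TZ]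
    have := TZ_nonneg N s
    have : 0 ≤ ((N + 1 : ℕ) : ℝ) ^ (-(a : ℤ)) * TZ N s := by positivity
    linarith

theorem TZ_le_log (s : List ℕ) (hs : ∀ x ∈ s, 0 < x) (N : ℕ) :
    TZ N s ≤ (1 + Real.log N) ^ s.length := by
  induction s with
  | nil => simp [TZ_nil]
  | cons a s ih =>
    have ha : 0 < a := hs a (by simp)
    have ih := ih (fun x hx => hs x (by simp [hx]))
    rw [TZ_cons_sum, List.length_cons, pow_succ']
    have hH := harmonic_le_one_add_log N
    have hN : (0 : ℝ) ≤ (1 + Real.log N) ^ s.length := (TZ_nonneg N s).trans ih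
    calc _ ≤ ∑ k ∈ Finset.range N, ((k + 1 : ℕ) : ℝ)⁻¹ * (1 + Real.log N) ^ s.length := by
          apply Finset.sum_le_sum
          intro k hk
          apply mul_le_mul
          · rw [← zpow_neg_one]
            apply zpow_le_zpow_right₀
            · push_cast; linarith [(Nat.cast_nonneg k : (0:ℝ) ≤ k)]
            · omega
          · exact (TZ_mono s (Finset.mem_range.1 hk).le).trans ih
          · exact TZ_nonneg _ _
          · positivity
      _ ≤ _ := by
          rw [← Finset.sum_mul]
          apply mul_le_mul_of_nonneg_right _ hN
          simpa [harmonic] using hH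

theorem log_summable (r : ℕ) :
    Summable fun k : ℕ => ((k : ℝ) ^ 2)⁻¹ * (1 + Real.log k) ^ r := by
  have h1 : (fun x : ℝ => (1 + Real.log x)) =O[Filter.atTop] Real.log := by
    apply Asymptotics.IsBigO.add _ (Asymptotics.isBigO_refl _ _)
    exact (Real.isLittleO_const_log_atTop (c := 1)).isBigO
  have h2 : (fun x : ℝ => (1 + Real.log x) ^ r) =O[Filter.atTop] fun x => x ^ (1 / 2 : ℝ) := by
    refine (h1.pow r).trans ?_
    have := (isLittleO_log_rpow_rpow_atTop (r : ℝ) (s := 1 / 2) (by norm_num)).isBigO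
    simpa using this
  have h3 : (fun k : ℕ => ((k : ℝ) ^ 2)⁻¹ * (1 + Real.log k) ^ r) =O[Filter.atTop]
      fun k : ℕ => ((k : ℝ) ^ 2)⁻¹ * (k : ℝ) ^ (1 / 2 : ℝ) :=
    (Asymptotics.isBigO_refl _ _).mul (h2.comp_tendsto tendsto_natCast_atTop_atTop)
  refine summable_of_isBigO_nat ?_ h3
  have h4 : Summable fun k : ℕ => (k : ℝ) ^ (-(3 / 2) : ℝ) := by
    rw [Real.summable_nat_rpow]; norm_num
  refine h4.congr_cofinite ?_
  rw [Nat.cofinite_eq_atTop]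
  filter_upwards [Filter.eventually_gt_atTop 0] with k hk
  have hk : (0 : ℝ) < k := by exact_mod_cast hk
  rw [← Real.rpow_natCast, ← Real.rpow_neg hk.le, ← Real.rpow_add hk]
  norm_num

theorem TZ_bdd (a : ℕ) (ha : 2 ≤ a) (s : List ℕ) (hs : ∀ x ∈ s, 0 < x) :
    ∃ C, ∀ N, TZ N (a :: s) ≤ C := by
  have hsum := (summable_nat_add_iff 1).2 (log_summable s.length)
  refine ⟨∑' k : ℕ, (((k + 1 : ℕ) : ℝ) ^ 2)⁻¹ * (1 + Real.log ((k + 1 : ℕ) : ℝ)) ^ s.length,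
    fun N => ?_⟩
  · rw [TZ_cons_sum]
    refine le_trans (Finset.sum_le_sum ?_) (hsum.sum_le_tsum (Finset.range N) ?_)
    · intro k hk
      apply mul_le_mul
      · rw [← zpow_natCast, ← zpow_neg]
        apply zpow_le_zpow_right₀
        · push_cast; linarith [(Nat.cast_nonneg k : (0:ℝ) ≤ k)]
        · push_cast; omega
      · exact (TZ_mono s (Nat.le_succ k)).trans (TZ_le_log s hs (k + 1))
      · exact TZ_nonneg _ _
      · positivity
    · intro k hk
      have : 0 ≤ Real.log ((k + 1 : ℕ) : ℝ) := Real.log_natCast_nonneg _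
      positivity

open Classical in
/-- Truncated index set. -/
noncomputable def AZ (N r : ℕ) : Finset (Fin r → ℕ) :=
  (Fintype.piFinset fun _ => Finset.Icc 1 N).filter StrictAnti

theorem mem_AZ {N r : ℕ} {n : Fin r → ℕ} :
    n ∈ AZ N r ↔ (∀ i, 1 ≤ n i ∧ n i ≤ N) ∧ StrictAnti n := by
  simp [AZ]

theorem AZ_succ (N r : ℕ) (f : (Fin (r + 1) → ℕ) → ℝ) :
    ∑ n ∈ AZ (N + 1) (r + 1), f n =
      ∑ n ∈ AZ N (r + 1), f n + ∑ m ∈ AZ N r, f (Fin.cons (N + 1) m) := by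
  classical
  rw [← Finset.sum_filter_not_add_sum_filter (AZ (N + 1) (r + 1)) (fun n => n 0 = N + 1)]
  congr 1
  · apply Finset.sum_congr _ (fun _ _ => rfl)
    ext n
    simp only [Finset.mem_filter, mem_AZ]
    constructor
    · rintro ⟨⟨h1, h2⟩, h3⟩
      refine ⟨fun i => ⟨(h1 i).1, ?_⟩, h2⟩
      have := h2.antitone (Fin.zero_le i)
      have := (h1 0).2
      omega
    · rintro ⟨h1, h2⟩
      refine ⟨⟨fun i => ⟨(h1 i).1, by have := (h1 i).2; omega⟩, h2⟩, ?_⟩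
      have := (h1 0).2
      omega
  · symm
    refine Finset.sum_nbij' (fun m => Fin.cons (N + 1) m) (fun n => Fin.tail n) ?_ ?_ ?_ ?_ ?_
    · intro m hm
      rw [mem_AZ] at hm
      simp only [Finset.mem_filter, mem_AZ]
      refine ⟨⟨?_, ?_⟩, rfl⟩
      · intro i
        refine Fin.cases ?_ (fun j => ?_) i
        · simp
        · have := hm.1 j
          simp only [Fin.cons_succ]
          omega
      · intro i j
        refine Fin.cases ?_ (fun i => ?_) i <;> refine Fin.cases ?_ (fun j => ?_) j
        · simp
        · intro _
          have := hm.1 j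
          simp only [Fin.cons_succ, Fin.cons_zero]
          omega
        · intro h; simp at h
        · intro h
          simpa using hm.2 (Fin.succ_lt_succ_iff.1 h)
    · intro n hn
      simp only [Finset.mem_filter, mem_AZ] at hn
      obtain ⟨⟨h1, h2⟩, h3⟩ := hn
      rw [mem_AZ]
      refine ⟨fun i => ⟨(h1 i.succ).1, ?_⟩, fun i j h => h2 (Fin.succ_lt_succ_iff.2 h)⟩
      have := h2 (Fin.succ_pos i)
      simp only [Fin.tail]
      omega
    · intro m hm; simp
    · intro n hn
      simp only [Finset.mem_filter, mem_AZ] at hn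
      rw [← hn.2]
      exact Fin.cons_self_tail n
    · intro m hm; rfl

theorem TZ_eq_sum (N : ℕ) : ∀ s : List ℕ, TZ N s =
    ∑ n ∈ AZ N s.length, ∏ i : Fin s.length, ((n i : ℝ)) ^ (-(s.get i : ℤ)) := by
  have hnil : ∀ N, AZ N 0 = Finset.univ := by
    intro N
    ext n
    simp only [mem_AZ, Finset.mem_univ, iff_true]
    exact ⟨fun i => i.elim0, fun i => i.elim0⟩
  induction N with
  | zero =>
    intro s
    cases s with
    | nil => simp [TZ, hnil]
    | cons a s =>
      have : AZ 0 (a :: s).length = ∅ := by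
        ext n
        simp only [mem_AZ, Finset.notMem_empty, iff_false]
        rintro ⟨h, -⟩
        have := h ⟨0, by simp⟩
        omega
      rw [this]
      simp [TZ]
  | succ N ih =>
    intro s
    cases s with
    | nil => simp [TZ, hnil]
    | cons a s =>
      rw [TZ, ih (a :: s), ih s]
      refine Eq.trans ?_ (AZ_succ N s.length _).symm
      congr 1
      rw [Finset.mul_sum]
      apply Finset.sum_congr rfl
      intro m hm
      refine Eq.trans ?_ (Fin.prod_univ_succ _).symm
      simp

theorem TZ_tendsto (s : List ℕ) (hs : ∃ C, ∀ N, TZ N s ≤ C) :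
    Filter.Tendsto (fun N => TZ N s) Filter.atTop (nhds (Ze s)) := by
  classical
  obtain ⟨C, hC⟩ := hs
  let B : ℕ → Finset {n : Fin s.length → ℕ // StrictAnti n ∧ ∀ i, 0 < n i} :=
    fun N => (AZ N s.length).subtype _
  have hB : ∀ N, ∑ n ∈ B N, ∏ i : Fin s.length, ((n.1 i : ℝ)) ^ (-(s.get i : ℤ)) = TZ N s := by
    intro N
    rw [TZ_eq_sum]
    refine Finset.sum_subtype_of_mem
      (fun n : Fin s.length → ℕ => ∏ i : Fin s.length, ((n i : ℝ)) ^ (-(s.get i : ℤ))) ?_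
    intro n hn
    rw [mem_AZ] at hn
    exact ⟨hn.2, fun i => (hn.1 i).1⟩
  have hT : Filter.Tendsto B Filter.atTop Filter.atTop := by
    apply Filter.tendsto_atTop_finset_of_monotone
    · intro M N h n hn
      simp only [B, Finset.mem_subtype, mem_AZ] at hn ⊢
      exact ⟨fun i => ⟨(hn.1 i).1, (hn.1 i).2.trans h⟩, hn.2⟩
    · intro n
      refine ⟨∑ i, n.1 i, ?_⟩
      simp only [B, Finset.mem_subtype, mem_AZ]
      exact ⟨fun i => ⟨n.2.2 i, Finset.single_le_sum (f := n.1) (fun _ _ => Nat.zero_le _)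
        (Finset.mem_univ i)⟩, n.2.1⟩
  have hsum : Summable fun n : {n : Fin s.length → ℕ // StrictAnti n ∧ ∀ i, 0 < n i} =>
      ∏ i : Fin s.length, ((n.1 i : ℝ)) ^ (-(s.get i : ℤ)) := by
    have h0 : ∀ n : {n : Fin s.length → ℕ // StrictAnti n ∧ ∀ i, 0 < n i},
      0 ≤ ∏ i : Fin s.length, ((n.1 i : ℝ)) ^ (-(s.get i : ℤ)) := fun n => by positivity
    refine summable_of_sum_le h0 (c := C) fun u => ?_
    obtain ⟨N, hN⟩ := (hT.eventually_ge_atTop u).exists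
    refine (Finset.sum_le_sum_of_subset_of_nonneg hN fun n _ _ => h0 n).trans ?_
    rw [hB]
    exact hC N
  have := hsum.hasSum.comp hT
  refine this.congr fun N => ?_
  exact hB N

theorem she_pos (s t : List ℕ) (hs : ∀ x ∈ s, 0 < x) (ht : ∀ x ∈ t, 0 < x) :
    ∀ w ∈ she s t, ∀ x ∈ w, 0 < x := by
  induction s, t using she.induct with
  | case1 t => simpa [she] using ht
  | case2 a s => simpa [she] using hs
  | case3 a s b t ih1 ih2 ih3 =>
    have hs' : ∀ x ∈ s, 0 < x := fun x hx => hs x (by simp [hx])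
    have ht' : ∀ x ∈ t, 0 < x := fun x hx => ht x (by simp [hx])
    have ha := hs a (by simp)
    have hb := ht b (by simp)
    intro w hw
    rw [she] at hw
    simp only [Multiset.mem_add, Multiset.mem_map] at hw
    rcases hw with (⟨v, hv, rfl⟩ | ⟨v, hv, rfl⟩) | ⟨v, hv, rfl⟩
    · have := ih1 hs' ht v hv
      simpa [ha] using this
    · have := ih2 hs ht' v hv
      simpa [hb] using this
    · have := ih3 hs' ht' v hv
      simpa [ha] using this

theorem multizeta_symmetrel
    (s' s'' : List ℕ) (h' : s' ≠ []) (h'' : s'' ≠ [])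
    (hpos' : ∀ x ∈ s', 0 < x) (hpos'' : ∀ x ∈ s'', 0 < x)
    (hfirst' : 2 ≤ s'.headI) (hfirst'' : 2 ≤ s''.headI) :
    Ze s' * Ze s'' = ((she s' s'').map Ze).sum := by
  have key : ∀ w : List ℕ, (∀ x ∈ w, 0 < x) → 2 ≤ w.headI →
      Filter.Tendsto (fun N => TZ N w) Filter.atTop (nhds (Ze w)) := by
    intro w hw h2
    apply TZ_tendsto
    cases w with
    | nil => simp at h2
    | cons a s => exact TZ_bdd a h2 s (fun x hx => hw x (by simp [hx]))
  have hhead : ∀ w ∈ she s' s'', 2 ≤ w.headI := by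
    cases s' with
    | nil => simp at h'
    | cons a s =>
      cases s'' with
      | nil => simp at h''
      | cons b t =>
        simp only [List.headI_cons] at hfirst' hfirst''
        intro w hw
        rw [she] at hw
        simp only [Multiset.mem_add, Multiset.mem_map] at hw
        rcases hw with (⟨v, hv, rfl⟩ | ⟨v, hv, rfl⟩) | ⟨v, hv, rfl⟩ <;>
          simp only [List.headI_cons] <;> omega
  have hp := she_pos s' s'' hpos' hpos''
  have h1 := (key s' hpos' hfirst').mul (key s'' hpos'' hfirst'')
  have h2 : Filter.Tendsto (fun N => ((she s' s'').map (TZ N)).sum) Filter.atTop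
      (nhds ((she s' s'').map Ze).sum) :=
    tendsto_multiset_sum (f := fun w N => TZ N w) _ fun w hw => key w (hp w hw) (hhead w hw)
  refine tendsto_nhds_unique h1 (h2.congr fun N => ?_)
  exact (TZ_mul N s' s'').symm
end

section
/- The following weight-11 double-zeta identity holds: 20·Ze^{11} + 56·Ze^{9,2} − 70·Ze^{8,3} − 112·Ze^{3,8} + 54·Ze^{7,4} + 42·Ze^{4,7} − 20·Ze^{6,5} − 20·Ze^{5,6} = 0. (It expresses the vanishing of the coefficient of the monotangent Te^{1} in the reduction of the multitangent Te^{2,6,4}.) -/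
/-- `Ze^a = ∑_{n ≥ 1} n^{-a}`. -/
noncomputable def Ze1 (a : ℕ) : ℝ :=
  ∑' n : {n : ℕ // 1 ≤ n}, ((n : ℕ) : ℝ) ^ (-(a : ℤ))

/-- `Ze^{a,b} = ∑_{m > n ≥ 1} m^{-a} n^{-b}`. -/
noncomputable def Ze2 (a b : ℕ) : ℝ :=
  ∑' p : {p : ℕ × ℕ // 1 ≤ p.2 ∧ p.2 < p.1},
    ((p.1.1 : ℕ) : ℝ) ^ (-(a : ℤ)) * ((p.1.2 : ℕ) : ℝ) ^ (-(b : ℤ))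

noncomputable def wq (a b : ℕ) (p : ℕ × ℕ) : ℝ :=
  (((p.1 : ℝ) + p.2 + 2) ^ a)⁻¹ * (((p.1 : ℝ) + 1) ^ b)⁻¹

noncomputable def wp (a b : ℕ) (p : ℕ × ℕ) : ℝ :=
  (((p.1 : ℝ) + 1) ^ a)⁻¹ * (((p.2 : ℝ) + 1) ^ b)⁻¹

lemma w_summable1 (a : ℕ) (ha : 2 ≤ a) : Summable (fun n : ℕ => (((n : ℝ) + 1) ^ a)⁻¹) := by
  have h := (summable_nat_add_iff (f := fun n : ℕ => ((n : ℝ) ^ a)⁻¹) 1).2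
    (Real.summable_nat_pow_inv.2 (by omega))
  simpa using h

lemma wp_summable (a b : ℕ) (ha : 2 ≤ a) (hb : 2 ≤ b) : Summable (wp a b) :=
  (w_summable1 a ha).mul_of_nonneg (w_summable1 b hb) (fun n => by positivity)
    (fun n => by positivity)

lemma wq_summable (a b : ℕ) (ha : 2 ≤ a) (hab : 4 ≤ a + b) : Summable (wq a b) := by
  obtain ⟨c, rfl⟩ := Nat.exists_eq_add_of_le ha
  refine Summable.of_nonneg_of_le (fun p => ?_) (fun p => ?_)
    (wp_summable (c + b) 2 (by omega) le_rfl)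
  · unfold wq; positivity
  · unfold wq wp
    rw [← mul_inv, ← mul_inv]
    apply inv_anti₀ (by positivity)
    rw [pow_add, pow_add]
    have h1 : ((p.1 : ℝ) + 1) ^ c ≤ ((p.1 : ℝ) + p.2 + 2) ^ c := by
      gcongr ?_ ^ c
      have : (0 : ℝ) ≤ p.2 := by positivity
      linarith
    have h2 : ((p.2 : ℝ) + 1) ^ 2 ≤ ((p.1 : ℝ) + p.2 + 2) ^ 2 := by
      gcongr ?_ ^ 2
      have : (0 : ℝ) ≤ p.1 := by positivity
      linarith
    calc ((p.1 : ℝ) + 1) ^ c * ((p.1 : ℝ) + 1) ^ b * ((p.2 : ℝ) + 1) ^ 2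
        ≤ ((p.1 : ℝ) + p.2 + 2) ^ c * ((p.1 : ℝ) + 1) ^ b * ((p.1 : ℝ) + p.2 + 2) ^ 2 := by
          gcongr
      _ = _ := by ring

lemma wZe1_hasSum (a : ℕ) (ha : 2 ≤ a) :
    HasSum (fun n : ℕ => (((n : ℝ) + 1) ^ a)⁻¹) (Ze1 a) := by
  let e : ℕ ≃ {n : ℕ // 1 ≤ n} :=
    { toFun := fun n => ⟨n + 1, by omega⟩
      invFun := fun n => n.1 - 1
      left_inv := fun n => by simp
      right_inv := fun n => by
        have := n.2
        apply Subtype.ext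
        simp only
        omega }
  have h : Ze1 a = ∑' n : ℕ, (((n : ℝ) + 1) ^ a)⁻¹ := by
    unfold Ze1
    rw [← e.tsum_eq]
    refine tsum_congr fun n => ?_
    simp [e]
  rw [h]
  exact (w_summable1 a ha).hasSum

lemma wZe2_hasSum (a b : ℕ) (ha : 2 ≤ a) (hab : 4 ≤ a + b) : HasSum (wq a b) (Ze2 a b) := by
  let e : ℕ × ℕ ≃ {p : ℕ × ℕ // 1 ≤ p.2 ∧ p.2 < p.1} :=
    { toFun := fun p => ⟨(p.1 + p.2 + 2, p.1 + 1), by constructor <;> simp <;> omega⟩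
      invFun := fun p => (p.1.2 - 1, p.1.1 - p.1.2 - 1)
      left_inv := fun p => by
        ext <;> simp <;> omega
      right_inv := fun p => by
        obtain ⟨⟨m, n⟩, h1, h2⟩ := p
        simp only at h1 h2
        apply Subtype.ext
        apply Prod.ext <;> simp only <;> omega }
  have h : Ze2 a b = ∑' p : ℕ × ℕ, wq a b p := by
    unfold Ze2
    rw [← e.tsum_eq]
    refine tsum_congr fun n => ?_
    simp [e, wq]
  rw [h]
  exact (wq_summable a b ha hab).hasSum

lemma w_stuffle (a b : ℕ) (ha : 2 ≤ a) (hb : 2 ≤ b) :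
    HasSum (wp a b) (Ze2 a b + Ze2 b a + Ze1 (a + b)) := by
  have h1 : HasSum (fun p : ℕ × ℕ => if p.2 < p.1 then wp a b p else 0) (Ze2 a b) := by
    have hg : Function.Injective (fun p : ℕ × ℕ => (p.1 + p.2 + 1, p.1)) := by
      rintro ⟨i, j⟩ ⟨k, l⟩ h
      simp only [Prod.mk.injEq] at h ⊢
      omega
    rw [← hg.hasSum_iff]
    · convert wZe2_hasSum a b ha (by omega) using 1
      funext p
      have : p.1 < p.1 + p.2 + 1 := by omega
      simp only [Function.comp, this, if_true, wp, wq]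
      push_cast
      ring_nf
    · rintro ⟨i, j⟩ h
      refine if_neg fun hlt => h ⟨(j, i - j - 1), ?_⟩
      simp only at hlt
      simp only [Prod.mk.injEq, and_true]
      omega
  have h2 : HasSum (fun p : ℕ × ℕ => if p.1 < p.2 then wp a b p else 0) (Ze2 b a) := by
    have hg : Function.Injective (fun p : ℕ × ℕ => (p.1, p.1 + p.2 + 1)) := by
      rintro ⟨i, j⟩ ⟨k, l⟩ h
      simp only [Prod.mk.injEq] at h ⊢
      omega
    rw [← hg.hasSum_iff]
    · convert wZe2_hasSum b a hb (by omega) using 1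
      funext p
      have : p.1 < p.1 + p.2 + 1 := by omega
      simp only [Function.comp, this, if_true, wp, wq]
      push_cast
      ring_nf
    · rintro ⟨i, j⟩ h
      refine if_neg fun hlt => h ⟨(i, j - i - 1), ?_⟩
      simp only at hlt
      simp only [Prod.mk.injEq, true_and]
      omega
  have h3 : HasSum (fun p : ℕ × ℕ => if p.1 = p.2 then wp a b p else 0) (Ze1 (a + b)) := by
    have hg : Function.Injective (fun p : ℕ => (p, p)) := by
      intro i j h
      simpa using h
    rw [← hg.hasSum_iff]
    · convert wZe1_hasSum (a + b) (by omega) using 1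
      funext p
      simp only [Function.comp, if_true, wp]
      rw [pow_add, mul_inv]
    · rintro ⟨i, j⟩ h
      refine if_neg fun hlt => h ⟨i, ?_⟩
      simp only at hlt
      simp [hlt]
  convert (h1.add h2).add h3 using 1
  funext p
  rcases lt_trichotomy p.1 p.2 with h | h | h
  · simp [h, h.ne, h.le]
  · simp [h]
  · simp [h, h.ne', h.le]

lemma w_shuffle (a b : ℕ)
    (hpt : ∀ x y s : ℝ, 0 < x → 0 < y → s = x + y → (x ^ a)⁻¹ * (y ^ b)⁻¹ =
      ∑ k ∈ Finset.Icc 2 10, (((k - 1).choose (a - 1) : ℝ) * ((s ^ k)⁻¹ * (y ^ (11 - k))⁻¹) +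
        ((k - 1).choose (b - 1) : ℝ) * ((s ^ k)⁻¹ * (x ^ (11 - k))⁻¹))) :
    HasSum (wp a b) (∑ k ∈ Finset.Icc 2 10, (((k - 1).choose (a - 1) : ℝ) * Ze2 k (11 - k) +
        ((k - 1).choose (b - 1) : ℝ) * Ze2 k (11 - k))) := by
  have h : HasSum (fun p : ℕ × ℕ => ∑ k ∈ Finset.Icc 2 10,
      (((k - 1).choose (a - 1) : ℝ) * wq k (11 - k) p.swap +
        ((k - 1).choose (b - 1) : ℝ) * wq k (11 - k) p))
      (∑ k ∈ Finset.Icc 2 10, (((k - 1).choose (a - 1) : ℝ) * Ze2 k (11 - k) +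
        ((k - 1).choose (b - 1) : ℝ) * Ze2 k (11 - k))) := by
    refine hasSum_sum fun k hk => ?_
    rw [Finset.mem_Icc] at hk
    have hz := wZe2_hasSum k (11 - k) hk.1 (by omega)
    exact (((Equiv.prodComm ℕ ℕ).hasSum_iff.2 hz).mul_left _).add (hz.mul_left _)
  convert h using 1
  funext p
  have := hpt ((p.1 : ℝ) + 1) ((p.2 : ℝ) + 1) ((p.1 : ℝ) + p.2 + 2) (by positivity)
    (by positivity) (by ring)
  simp only [wp, wq, Prod.fst_swap, Prod.snd_swap]
  rw [this]
  refine Finset.sum_congr rfl fun k _ => ?_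
  rw [add_comm (p.2 : ℝ) (p.1 : ℝ)]

lemma w_rel (a b : ℕ) (ha : 2 ≤ a) (hb : 2 ≤ b) (hab : a + b = 11)
    (hpt : ∀ x y s : ℝ, 0 < x → 0 < y → s = x + y → (x ^ a)⁻¹ * (y ^ b)⁻¹ =
      ∑ k ∈ Finset.Icc 2 10, (((k - 1).choose (a - 1) : ℝ) * ((s ^ k)⁻¹ * (y ^ (11 - k))⁻¹) +
        ((k - 1).choose (b - 1) : ℝ) * ((s ^ k)⁻¹ * (x ^ (11 - k))⁻¹))) :
    Ze2 a b + Ze2 b a + Ze1 11 =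
     (∑ k ∈ Finset.Icc 2 10, (((k - 1).choose (a - 1) : ℝ) * Ze2 k (11 - k) +
        ((k - 1).choose (b - 1) : ℝ) * Ze2 k (11 - k))) := by
  have h := w_stuffle a b ha hb
  rw [hab] at h
  exact h.unique (w_shuffle a b hpt)

lemma w_Icc : Finset.Icc 2 10 = ({2, 3, 4, 5, 6, 7, 8, 9, 10} : Finset ℕ) := by decide

/-- Weight-11 double-zeta identity: vanishing of the coefficient of `Te^1` in the reduction of
the multitangent `Te^{2,6,4}`. -/
theorem weight11_double_zeta_identity :
    20 * Ze1 11 + 56 * Ze2 9 2 - 70 * Ze2 8 3 - 112 * Ze2 3 8 + 54 * Ze2 7 4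
      + 42 * Ze2 4 7 - 20 * Ze2 6 5 - 20 * Ze2 5 6 = 0 := by
  have r1 := w_rel 2 9 (by norm_num) (by norm_num) rfl (by
    rintro x y s hx hy rfl
    simp [w_Icc, Nat.choose]
    field_simp
    ring)
  have r2 := w_rel 3 8 (by norm_num) (by norm_num) rfl (by
    rintro x y s hx hy rfl
    simp [w_Icc, Nat.choose]
    field_simp
    ring)
  have r3 := w_rel 4 7 (by norm_num) (by norm_num) rfl (by
    rintro x y s hx hy rfl
    simp [w_Icc, Nat.choose]
    field_simp
    ring)
  have r4 := w_rel 5 6 (by norm_num) (by norm_num) rfl (by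
    rintro x y s hx hy rfl
    simp [w_Icc, Nat.choose]
    field_simp
    ring)
  simp [w_Icc, Nat.choose] at r1 r2 r3 r4
  linear_combination 56 * r1 - 70 * r2 + 54 * r3 - 20 * r4
end

section
/- The following weight-12 double-zeta identity holds: 30·Ze^{12} + 84·Ze^{10,2} − 112·Ze^{9,3} − 168·Ze^{3,9} + 112·Ze^{8,4} + 84·Ze^{4,8} − 104·Ze^{7,5} − 112·Ze^{5,7} + 100·Ze^{6,6} = 0. (It expresses the vanishing of the coefficient of the monotangent Te^{1} in the reduction of the multitangent Te^{2,7,4}.) -/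
noncomputable def gZ (s t : ℕ) (p : ℕ × ℕ) : ℝ :=
  (((p.1 : ℝ) + 1 + ((p.2 : ℝ) + 1))⁻¹) ^ s * (((p.2 : ℝ) + 1)⁻¹) ^ t

noncomputable def fZ (a b : ℕ) (p : ℕ × ℕ) : ℝ :=
  (((p.1 : ℝ) + 1)⁻¹) ^ a * (((p.2 : ℝ) + 1)⁻¹) ^ b

lemma Ze1_eq (a : ℕ) : Ze1 a = ∑' n : ℕ, (((n : ℝ) + 1)⁻¹) ^ a := by
  unfold Ze1
  let e : ℕ ≃ {n : ℕ // 1 ≤ n} :=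
    { toFun := fun n => ⟨n + 1, by omega⟩
      invFun := fun n => n.1 - 1
      left_inv := fun n => by simp
      right_inv := fun n => by
        rcases n with ⟨n, hn⟩
        simp only [Subtype.mk.injEq]; omega }
  rw [← e.tsum_eq]
  refine tsum_congr fun n => ?_
  simp [e]

lemma Ze2_eq (a b : ℕ) : Ze2 a b = ∑' p, gZ a b p := by
  unfold Ze2
  let e : ℕ × ℕ ≃ {p : ℕ × ℕ // 1 ≤ p.2 ∧ p.2 < p.1} :=
    { toFun := fun p => ⟨(p.1 + 1 + (p.2 + 1), p.2 + 1), by constructor <;> dsimp only <;> omega⟩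
      invFun := fun p => (p.1.1 - p.1.2 - 1, p.1.2 - 1)
      left_inv := fun p => by
        rcases p with ⟨i, j⟩
        simp only [Prod.mk.injEq]; omega
      right_inv := fun p => by
        rcases p with ⟨⟨i, j⟩, h1, h2⟩
        dsimp only at h1 h2
        simp only [Subtype.mk.injEq, Prod.mk.injEq]; omega }
  rw [← e.tsum_eq]
  refine tsum_congr fun p => ?_
  simp [e, gZ]

lemma summ1 (a : ℕ) (ha : 2 ≤ a) : Summable (fun n : ℕ => (((n : ℝ) + 1)⁻¹) ^ a) := by
  have h := (summable_nat_add_iff 1).2 (Real.summable_nat_pow_inv.2 (show 1 < a by omega))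
  refine h.congr fun n => ?_
  push_cast
  rw [inv_pow]

lemma summ_f (a b : ℕ) (ha : 2 ≤ a) (hb : 2 ≤ b) : Summable (fZ a b) :=
  (summ1 a ha).mul_of_nonneg (summ1 b hb) (fun n => by dsimp only; positivity)
    (fun n => by dsimp only; positivity)

lemma summ_g (s t : ℕ) (hs : 2 ≤ s) (hst : 4 ≤ s + t) : Summable (gZ s t) := by
  refine Summable.of_nonneg_of_le (fun p => by unfold gZ; positivity) (fun p => ?_)
    (summ_f 2 (s + t - 2) le_rfl (by omega))
  unfold gZ fZ
  obtain ⟨r, rfl⟩ : ∃ r, s = 2 + r := ⟨s - 2, by omega⟩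
  have e : 2 + r + t - 2 = r + t := by omega
  rw [e, pow_add, pow_add, mul_assoc]
  have h1 : ((p.1 : ℝ) + 1 + ((p.2 : ℝ) + 1))⁻¹ ≤ ((p.1 : ℝ) + 1)⁻¹ :=
    inv_anti₀ (by positivity) (by linarith [(Nat.cast_nonneg p.2 : (0 : ℝ) ≤ p.2)])
  have h2 : ((p.1 : ℝ) + 1 + ((p.2 : ℝ) + 1))⁻¹ ≤ ((p.2 : ℝ) + 1)⁻¹ :=
    inv_anti₀ (by positivity) (by linarith [(Nat.cast_nonneg p.1 : (0 : ℝ) ≤ p.1)])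
  gcongr

lemma upper (a b : ℕ) : Ze2 a b = ∑' p : ℕ × ℕ, if p.2 < p.1 then fZ a b p else 0 := by
  rw [Ze2_eq]
  let g : ℕ × ℕ → ℕ × ℕ := fun p => (p.1 + p.2 + 1, p.2)
  have hg : Function.Injective g := by
    rintro ⟨i, j⟩ ⟨k, l⟩ h
    simp only [g, Prod.mk.injEq] at h ⊢
    omega
  rw [← hg.tsum_eq (f := fun p : ℕ × ℕ => if p.2 < p.1 then fZ a b p else 0)]
  · refine tsum_congr fun p => ?_
    have : p.2 < p.1 + p.2 + 1 := by omega
    simp only [g, this, if_true, gZ, fZ]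
    push_cast
    congr 3
    ring
  · rintro ⟨i, j⟩ h
    have : j < i := by
      by_contra hc
      simp [hc] at h
    exact ⟨(i - j - 1, j), Prod.ext (show i - j - 1 + j + 1 = i by omega) rfl⟩

lemma lower (a b : ℕ) : Ze2 b a = ∑' p : ℕ × ℕ, if p.1 < p.2 then fZ a b p else 0 := by
  rw [upper, ← (Equiv.prodComm ℕ ℕ).tsum_eq]
  refine tsum_congr fun p => ?_
  simp [fZ, mul_comm]

lemma diag (a b : ℕ) : Ze1 (a + b) = ∑' p : ℕ × ℕ, if p.1 = p.2 then fZ a b p else 0 := by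
  rw [Ze1_eq]
  let g : ℕ → ℕ × ℕ := fun n => (n, n)
  have hg : Function.Injective g := fun i j h => (Prod.mk.inj h).1
  rw [← hg.tsum_eq]
  · refine tsum_congr fun p => ?_
    simp [g, fZ, pow_add]
  · rintro ⟨i, j⟩ h
    have : i = j := by
      by_contra hc
      simp [hc] at h
    exact ⟨i, by simp [g, this]⟩

lemma stuffle (a b : ℕ) (ha : 2 ≤ a) (hb : 2 ≤ b) :
    ∑' p, fZ a b p = Ze2 a b + Ze2 b a + Ze1 (a + b) := by
  have hs := summ_f a b ha hb
  have hsub : ∀ (P : ℕ × ℕ → Prop) [DecidablePred P],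
      Summable (fun p => if P p then fZ a b p else 0) := fun P _ => by
    refine Summable.of_nonneg_of_le (fun p => ?_) (fun p => ?_) hs
    · split_ifs
      · unfold fZ; positivity
      · exact le_rfl
    · split_ifs
      · exact le_rfl
      · unfold fZ; positivity
  rw [upper a b, lower a b, diag a b, ← Summable.tsum_add (hsub _) (hsub _),
    ← Summable.tsum_add ((hsub _).add (hsub _)) (hsub _)]
  refine tsum_congr fun p => ?_
  rcases lt_trichotomy p.1 p.2 with h | h | h
  · simp [h, h.ne, h.le]
  · simp [h]
  · simp [h, h.ne', h.le]

/-- symmetrised g -/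
lemma hasSum_G (s t : ℕ) (hs : 2 ≤ s) (hst : 4 ≤ s + t) : HasSum (gZ s t) (Ze2 s t) := by
  rw [Ze2_eq]; exact (summ_g s t hs hst).hasSum

lemma hasSum_G' (s t : ℕ) (hs : 2 ≤ s) (hst : 4 ≤ s + t) :
    HasSum (fun p : ℕ × ℕ => gZ s t p.swap) (Ze2 s t) :=
  (Equiv.prodComm ℕ ℕ).hasSum_iff.2 (hasSum_G s t hs hst)

lemma sh2 : ∑' p, fZ 2 10 p =
    1 * Ze2 2 10 +
      2 * Ze2 3 9 +
      3 * Ze2 4 8 +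
      4 * Ze2 5 7 +
      5 * Ze2 6 6 +
      6 * Ze2 7 5 +
      7 * Ze2 8 4 +
      8 * Ze2 9 3 +
      9 * Ze2 10 2 +
      1 * Ze2 10 2 +
      10 * Ze2 11 1 +
      10 * Ze2 11 1 := by
  have h := (((((((((((((hasSum_G 2 10 (by norm_num) (by norm_num)).mul_left 1).add
    ((hasSum_G 3 9 (by norm_num) (by norm_num)).mul_left 2)).add
    ((hasSum_G 4 8 (by norm_num) (by norm_num)).mul_left 3)).add
    ((hasSum_G 5 7 (by norm_num) (by norm_num)).mul_left 4)).add
    ((hasSum_G 6 6 (by norm_num) (by norm_num)).mul_left 5)).add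
    ((hasSum_G 7 5 (by norm_num) (by norm_num)).mul_left 6)).add
    ((hasSum_G 8 4 (by norm_num) (by norm_num)).mul_left 7)).add
    ((hasSum_G 9 3 (by norm_num) (by norm_num)).mul_left 8)).add
    ((hasSum_G 10 2 (by norm_num) (by norm_num)).mul_left 9)).add
    ((hasSum_G' 10 2 (by norm_num) (by norm_num)).mul_left 1)).add
    ((hasSum_G 11 1 (by norm_num) (by norm_num)).mul_left 10)).add
    ((hasSum_G' 11 1 (by norm_num) (by norm_num)).mul_left 10))
  rw [← h.tsum_eq]
  refine tsum_congr fun p => ?_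
  simp only [gZ, fZ, Prod.fst_swap, Prod.snd_swap]
  have h1 : (p.1 : ℝ) + 1 ≠ 0 := by positivity
  have h2 : (p.2 : ℝ) + 1 ≠ 0 := by positivity
  have h3 : (p.1 : ℝ) + 1 + ((p.2 : ℝ) + 1) ≠ 0 := by positivity
  have h4 : (p.2 : ℝ) + 1 + ((p.1 : ℝ) + 1) = (p.1 : ℝ) + 1 + ((p.2 : ℝ) + 1) := by ring
  rw [h4]
  generalize (p.1 : ℝ) + 1 = x at *
  generalize (p.2 : ℝ) + 1 = y at *
  field_simp
  ring

lemma sh3 : ∑' p, fZ 3 9 p =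
    1 * Ze2 3 9 +
      3 * Ze2 4 8 +
      6 * Ze2 5 7 +
      10 * Ze2 6 6 +
      15 * Ze2 7 5 +
      21 * Ze2 8 4 +
      28 * Ze2 9 3 +
      1 * Ze2 9 3 +
      36 * Ze2 10 2 +
      9 * Ze2 10 2 +
      45 * Ze2 11 1 +
      45 * Ze2 11 1 := by
  have h := (((((((((((((hasSum_G 3 9 (by norm_num) (by norm_num)).mul_left 1).add
    ((hasSum_G 4 8 (by norm_num) (by norm_num)).mul_left 3)).add
    ((hasSum_G 5 7 (by norm_num) (by norm_num)).mul_left 6)).add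
    ((hasSum_G 6 6 (by norm_num) (by norm_num)).mul_left 10)).add
    ((hasSum_G 7 5 (by norm_num) (by norm_num)).mul_left 15)).add
    ((hasSum_G 8 4 (by norm_num) (by norm_num)).mul_left 21)).add
    ((hasSum_G 9 3 (by norm_num) (by norm_num)).mul_left 28)).add
    ((hasSum_G' 9 3 (by norm_num) (by norm_num)).mul_left 1)).add
    ((hasSum_G 10 2 (by norm_num) (by norm_num)).mul_left 36)).add
    ((hasSum_G' 10 2 (by norm_num) (by norm_num)).mul_left 9)).add
    ((hasSum_G 11 1 (by norm_num) (by norm_num)).mul_left 45)).add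
    ((hasSum_G' 11 1 (by norm_num) (by norm_num)).mul_left 45))
  rw [← h.tsum_eq]
  refine tsum_congr fun p => ?_
  simp only [gZ, fZ, Prod.fst_swap, Prod.snd_swap]
  have h1 : (p.1 : ℝ) + 1 ≠ 0 := by positivity
  have h2 : (p.2 : ℝ) + 1 ≠ 0 := by positivity
  have h3 : (p.1 : ℝ) + 1 + ((p.2 : ℝ) + 1) ≠ 0 := by positivity
  have h4 : (p.2 : ℝ) + 1 + ((p.1 : ℝ) + 1) = (p.1 : ℝ) + 1 + ((p.2 : ℝ) + 1) := by ring
  rw [h4]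
  generalize (p.1 : ℝ) + 1 = x at *
  generalize (p.2 : ℝ) + 1 = y at *
  field_simp
  ring

lemma sh4 : ∑' p, fZ 4 8 p =
    1 * Ze2 4 8 +
      4 * Ze2 5 7 +
      10 * Ze2 6 6 +
      20 * Ze2 7 5 +
      35 * Ze2 8 4 +
      1 * Ze2 8 4 +
      56 * Ze2 9 3 +
      8 * Ze2 9 3 +
      84 * Ze2 10 2 +
      36 * Ze2 10 2 +
      120 * Ze2 11 1 +
      120 * Ze2 11 1 := by
  have h := (((((((((((((hasSum_G 4 8 (by norm_num) (by norm_num)).mul_left 1).add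
    ((hasSum_G 5 7 (by norm_num) (by norm_num)).mul_left 4)).add
    ((hasSum_G 6 6 (by norm_num) (by norm_num)).mul_left 10)).add
    ((hasSum_G 7 5 (by norm_num) (by norm_num)).mul_left 20)).add
    ((hasSum_G 8 4 (by norm_num) (by norm_num)).mul_left 35)).add
    ((hasSum_G' 8 4 (by norm_num) (by norm_num)).mul_left 1)).add
    ((hasSum_G 9 3 (by norm_num) (by norm_num)).mul_left 56)).add
    ((hasSum_G' 9 3 (by norm_num) (by norm_num)).mul_left 8)).add
    ((hasSum_G 10 2 (by norm_num) (by norm_num)).mul_left 84)).add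
    ((hasSum_G' 10 2 (by norm_num) (by norm_num)).mul_left 36)).add
    ((hasSum_G 11 1 (by norm_num) (by norm_num)).mul_left 120)).add
    ((hasSum_G' 11 1 (by norm_num) (by norm_num)).mul_left 120))
  rw [← h.tsum_eq]
  refine tsum_congr fun p => ?_
  simp only [gZ, fZ, Prod.fst_swap, Prod.snd_swap]
  have h1 : (p.1 : ℝ) + 1 ≠ 0 := by positivity
  have h2 : (p.2 : ℝ) + 1 ≠ 0 := by positivity
  have h3 : (p.1 : ℝ) + 1 + ((p.2 : ℝ) + 1) ≠ 0 := by positivity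
  have h4 : (p.2 : ℝ) + 1 + ((p.1 : ℝ) + 1) = (p.1 : ℝ) + 1 + ((p.2 : ℝ) + 1) := by ring
  rw [h4]
  generalize (p.1 : ℝ) + 1 = x at *
  generalize (p.2 : ℝ) + 1 = y at *
  field_simp
  ring

lemma sh5 : ∑' p, fZ 5 7 p =
    1 * Ze2 5 7 +
      5 * Ze2 6 6 +
      15 * Ze2 7 5 +
      1 * Ze2 7 5 +
      35 * Ze2 8 4 +
      7 * Ze2 8 4 +
      70 * Ze2 9 3 +
      28 * Ze2 9 3 +
      126 * Ze2 10 2 +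
      84 * Ze2 10 2 +
      210 * Ze2 11 1 +
      210 * Ze2 11 1 := by
  have h := (((((((((((((hasSum_G 5 7 (by norm_num) (by norm_num)).mul_left 1).add
    ((hasSum_G 6 6 (by norm_num) (by norm_num)).mul_left 5)).add
    ((hasSum_G 7 5 (by norm_num) (by norm_num)).mul_left 15)).add
    ((hasSum_G' 7 5 (by norm_num) (by norm_num)).mul_left 1)).add
    ((hasSum_G 8 4 (by norm_num) (by norm_num)).mul_left 35)).add
    ((hasSum_G' 8 4 (by norm_num) (by norm_num)).mul_left 7)).add
    ((hasSum_G 9 3 (by norm_num) (by norm_num)).mul_left 70)).add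
    ((hasSum_G' 9 3 (by norm_num) (by norm_num)).mul_left 28)).add
    ((hasSum_G 10 2 (by norm_num) (by norm_num)).mul_left 126)).add
    ((hasSum_G' 10 2 (by norm_num) (by norm_num)).mul_left 84)).add
    ((hasSum_G 11 1 (by norm_num) (by norm_num)).mul_left 210)).add
    ((hasSum_G' 11 1 (by norm_num) (by norm_num)).mul_left 210))
  rw [← h.tsum_eq]
  refine tsum_congr fun p => ?_
  simp only [gZ, fZ, Prod.fst_swap, Prod.snd_swap]
  have h1 : (p.1 : ℝ) + 1 ≠ 0 := by positivity
  have h2 : (p.2 : ℝ) + 1 ≠ 0 := by positivity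
  have h3 : (p.1 : ℝ) + 1 + ((p.2 : ℝ) + 1) ≠ 0 := by positivity
  have h4 : (p.2 : ℝ) + 1 + ((p.1 : ℝ) + 1) = (p.1 : ℝ) + 1 + ((p.2 : ℝ) + 1) := by ring
  rw [h4]
  generalize (p.1 : ℝ) + 1 = x at *
  generalize (p.2 : ℝ) + 1 = y at *
  field_simp
  ring

lemma sh6 : ∑' p, fZ 6 6 p =
    1 * Ze2 6 6 +
      1 * Ze2 6 6 +
      6 * Ze2 7 5 +
      6 * Ze2 7 5 +
      21 * Ze2 8 4 +
      21 * Ze2 8 4 +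
      56 * Ze2 9 3 +
      56 * Ze2 9 3 +
      126 * Ze2 10 2 +
      126 * Ze2 10 2 +
      252 * Ze2 11 1 +
      252 * Ze2 11 1 := by
  have h := (((((((((((((hasSum_G 6 6 (by norm_num) (by norm_num)).mul_left 1).add
    ((hasSum_G' 6 6 (by norm_num) (by norm_num)).mul_left 1)).add
    ((hasSum_G 7 5 (by norm_num) (by norm_num)).mul_left 6)).add
    ((hasSum_G' 7 5 (by norm_num) (by norm_num)).mul_left 6)).add
    ((hasSum_G 8 4 (by norm_num) (by norm_num)).mul_left 21)).add
    ((hasSum_G' 8 4 (by norm_num) (by norm_num)).mul_left 21)).add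
    ((hasSum_G 9 3 (by norm_num) (by norm_num)).mul_left 56)).add
    ((hasSum_G' 9 3 (by norm_num) (by norm_num)).mul_left 56)).add
    ((hasSum_G 10 2 (by norm_num) (by norm_num)).mul_left 126)).add
    ((hasSum_G' 10 2 (by norm_num) (by norm_num)).mul_left 126)).add
    ((hasSum_G 11 1 (by norm_num) (by norm_num)).mul_left 252)).add
    ((hasSum_G' 11 1 (by norm_num) (by norm_num)).mul_left 252))
  rw [← h.tsum_eq]
  refine tsum_congr fun p => ?_
  simp only [gZ, fZ, Prod.fst_swap, Prod.snd_swap]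
  have h1 : (p.1 : ℝ) + 1 ≠ 0 := by positivity
  have h2 : (p.2 : ℝ) + 1 ≠ 0 := by positivity
  have h3 : (p.1 : ℝ) + 1 + ((p.2 : ℝ) + 1) ≠ 0 := by positivity
  have h4 : (p.2 : ℝ) + 1 + ((p.1 : ℝ) + 1) = (p.1 : ℝ) + 1 + ((p.2 : ℝ) + 1) := by ring
  rw [h4]
  generalize (p.1 : ℝ) + 1 = x at *
  generalize (p.2 : ℝ) + 1 = y at *
  field_simp
  ring

/-- Weight-12 double-zeta identity: vanishing of the coefficient of `Te^1` in the reduction of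
the multitangent `Te^{2,7,4}`. -/
theorem weight12_double_zeta_identity :
    30 * Ze1 12 + 84 * Ze2 10 2 - 112 * Ze2 9 3 - 168 * Ze2 3 9 + 112 * Ze2 8 4
      + 84 * Ze2 4 8 - 104 * Ze2 7 5 - 112 * Ze2 5 7 + 100 * Ze2 6 6 = 0 := by
  have a2 := (stuffle 2 10 (by norm_num) (by norm_num)).symm.trans sh2
  have a3 := (stuffle 3 9 (by norm_num) (by norm_num)).symm.trans sh3
  have a4 := (stuffle 4 8 (by norm_num) (by norm_num)).symm.trans sh4
  have a5 := (stuffle 5 7 (by norm_num) (by norm_num)).symm.trans sh5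
  have a6 := (stuffle 6 6 (by norm_num) (by norm_num)).symm.trans sh6
  norm_num only at a2 a3 a4 a5 a6
  linear_combination 84 * a2 - 112 * a3 + 112 * a4 - 104 * a5 + 50 * a6
end

section
/- invTe is the multiplicative mould inverse of Te: let r ≥ 1 and let (s_1,…,s_r) be integers all ≥ 2. Then for every z ∈ ℂ ∖ ℤ, ∑_{k=0}^{r} Te^{s_1,…,s_k}(z) · invTe^{s_{k+1},…,s_r}(z) = 0, where for k = 0 and k = r the corresponding factor over the empty sequence equals 1. -/
/-- `invTe^{s₁,…,s_r}(z) = (−1)^r ∑_{n₁ ≤ n₂ ≤ ⋯ ≤ n_r, nᵢ ∈ ℤ} ∏ (nᵢ + z)^{-sᵢ}`;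
`invTe^{∅}(z) = 1`. -/
noncomputable def invTe (s : List ℕ) (z : ℂ) : ℂ :=
  (-1 : ℂ) ^ s.length *
    ∑' n : {n : Fin s.length → ℤ // Monotone n},
      ∏ i : Fin s.length, ((n.1 i : ℂ) + z) ^ (-(s.get i : ℤ))

noncomputable def mouldH (z : ℂ) : List ℕ → List ℤ → ℂ
  | [], [] => 1
  | x :: s, n :: l => ((n : ℂ) + z) ^ (-(x : ℤ)) * mouldH z s l
  | [], _ :: _ => 0
  | _ :: _, [] => 0

open Classical in
noncomputable def indP (P : List ℤ → Prop) (l : List ℤ) : ℂ := if P l then 1 else 0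

lemma indP_norm (P : List ℤ → Prop) (l : List ℤ) : ‖indP P l‖ ≤ 1 := by
  unfold indP; split_ifs <;> simp

lemma mouldH_length (z : ℂ) : ∀ (s : List ℕ) (l : List ℤ), mouldH z s l ≠ 0 → l.length = s.length
  | [], [] => by simp
  | x :: s, n :: l => by
      intro h
      have := mouldH_length z s l (by
        intro h0; apply h; simp [mouldH, h0])
      simp [this]
  | [], _ :: _ => by simp [mouldH]
  | _ :: _, [] => by simp [mouldH]

lemma mouldH_append (z : ℂ) (b : List ℕ) : ∀ (a : List ℕ) (l : List ℤ),
    mouldH z a (l.take a.length) * mouldH z b (l.drop a.length) = mouldH z (a ++ b) l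
  | [], l => by simp [mouldH]
  | x :: a, [] => by simp [mouldH]
  | x :: a, n :: l => by
      have := mouldH_append z b a l
      simp only [List.length_cons, List.take_succ_cons, List.drop_succ_cons, List.cons_append,
        mouldH, ← this, mul_assoc]

lemma mouldH_ofFn (z : ℂ) : ∀ (s : List ℕ) (n : Fin s.length → ℤ),
    mouldH z s (List.ofFn n) = ∏ i : Fin s.length, ((n i : ℂ) + z) ^ (-(s.get i : ℤ))
  | [], n => by simp [mouldH]
  | x :: s, n => by
      have := mouldH_ofFn z s (fun i => n i.succ)
      have h2 : List.ofFn n = n 0 :: List.ofFn (fun i : Fin s.length => n i.succ) :=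
        List.ofFn_succ (f := n)
      rw [h2, mouldH, this]
      exact (Fin.prod_univ_succ (n := s.length)
        (fun i => ((n i : ℂ) + z) ^ (-((x :: s).get i : ℤ)))).symm

lemma mould_summable (z : ℂ) : ∀ (s : List ℕ), (∀ x ∈ s, 2 ≤ x) →
    Summable (fun l => ‖mouldH z s l‖)
  | [], _ => by
      apply summable_of_ne_finset_zero (s := {[]})
      intro l hl
      cases l with
      | nil => simp at hl
      | cons => simp [mouldH]
  | x :: s, hs => by
      have ih := mould_summable z s (fun y hy => hs y (by simp [hy]))
      have hx : 2 ≤ x := hs x (by simp)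
      have h1 : Summable (fun n : ℤ => ‖((n : ℂ) + z) ^ (-(x : ℤ))‖) := by
        have := (EisensteinSeries.linear_right_summable z 1 (k := (x : ℤ)) (by exact_mod_cast hx)).norm
        refine this.congr fun n => ?_
        rw [zpow_neg]; simp [add_comm]
      have h2 := h1.mul_of_nonneg ih (fun _ => norm_nonneg _) (fun _ => norm_nonneg _)
      let g : ℤ × List ℤ → List ℤ := fun p => p.1 :: p.2
      have hg : Function.Injective g := by
        rintro ⟨a, b⟩ ⟨c, d⟩ h
        simpa [g] using h
      refine (hg.summable_iff ?_).1 (h2.congr ?_)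
      · intro l hl
        cases l with
        | nil => simp [mouldH]
        | cons n l => exact absurd ⟨(n, l), rfl⟩ hl
      · rintro ⟨n, l⟩
        simp [g, mouldH]

lemma ind_summable (z : ℂ) (s : List ℕ) (hs : ∀ x ∈ s, 2 ≤ x) (f : List ℤ → ℂ)
    (hf : ∀ l, ‖f l‖ ≤ 1) : Summable (fun l => ‖f l * mouldH z s l‖) := by
  refine (mould_summable z s hs).of_nonneg_of_le (fun _ => norm_nonneg _) fun l => ?_
  rw [norm_mul]
  exact mul_le_of_le_one_left (norm_nonneg _) (hf l)

lemma tsum_list (z : ℂ) (s : List ℕ) (P : List ℤ → Prop) (Q : (Fin s.length → ℤ) → Prop)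
    (h : ∀ n, Q n ↔ P (List.ofFn n)) :
    ∑' n : {n : Fin s.length → ℤ // Q n},
      ∏ i : Fin s.length, ((n.1 i : ℂ) + z) ^ (-(s.get i : ℤ)) =
    ∑' l, indP P l * mouldH z s l := by
  let g : {n : Fin s.length → ℤ // Q n} → List ℤ := fun n => List.ofFn n.1
  have hg : Function.Injective g := by
    intro a b hab
    exact Subtype.ext (List.ofFn_injective hab)
  rw [← hg.tsum_eq]
  · refine tsum_congr fun n => ?_
    have : P (List.ofFn n.1) := (h _).1 n.2
    simp only [g, mouldH_ofFn, indP, this, if_true, one_mul]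
  · intro l hl
    have hl := Function.mem_support.1 hl
    have h1 : P l := by
      by_contra h0
      simp [indP, h0] at hl
    have h2 := mouldH_length z s l (right_ne_zero_of_mul hl)
    have h3 : List.ofFn (fun i : Fin s.length => l.get (i.cast h2.symm)) = l := by
      apply List.ext_getElem <;> simp [h2]
    exact ⟨⟨_, (h _).2 (by rw [h3]; exact h1)⟩, h3⟩

lemma Te_list (s : List ℕ) (z : ℂ) :
    Te s z = ∑' l, indP (List.IsChain (· > ·)) l * mouldH z s l := by
  refine tsum_list z s _ _ fun n => ?_
  rw [List.isChain_iff_pairwise, List.pairwise_ofFn]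
  exact ⟨fun h i j hij => h hij, fun h i j hij => h hij⟩

lemma invTe_list (s : List ℕ) (z : ℂ) :
    invTe s z = (-1) ^ s.length * ∑' l, indP (List.IsChain (· ≤ ·)) l * mouldH z s l := by
  unfold invTe
  congr 1
  refine tsum_list z s _ _ fun n => ?_
  rw [List.isChain_iff_pairwise, List.pairwise_ofFn, monotone_iff_forall_lt]

noncomputable def cf (k : ℕ) (l : List ℤ) : ℂ :=
  indP (List.IsChain (· > ·)) (l.take k) * indP (List.IsChain (· ≤ ·)) (l.drop k)

lemma cf_norm (k : ℕ) (l : List ℤ) : ‖cf k l‖ ≤ 1 := by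
  unfold cf
  rw [norm_mul]
  exact mul_le_one₀ (indP_norm _ _) (norm_nonneg _) (indP_norm _ _)

lemma prod_list (a b : List ℕ) (z : ℂ) (ha : ∀ x ∈ a, 2 ≤ x) (hb : ∀ x ∈ b, 2 ≤ x) :
    Te a z * invTe b z = (-1) ^ b.length * ∑' l, cf a.length l * mouldH z (a ++ b) l := by
  rw [Te_list, invTe_list, mul_left_comm,
    tsum_mul_tsum_of_summable_norm (ind_summable z a ha _ (indP_norm _))
      (ind_summable z b hb _ (indP_norm _))]
  congr 1
  let g : List ℤ → List ℤ × List ℤ := fun l => (l.take a.length, l.drop a.length)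
  have hg : Function.Injective g := by
    intro l m h
    simp only [g, Prod.mk.injEq] at h
    rw [← List.take_append_drop a.length l, h.1, h.2, List.take_append_drop]
  rw [← hg.tsum_eq]
  · refine tsum_congr fun l => ?_
    simp only [g, cf, ← mouldH_append]
    ring
  · rintro ⟨p, q⟩ h
    have h := Function.mem_support.1 h
    have h2 := mouldH_length z a p (right_ne_zero_of_mul (left_ne_zero_of_mul h))
    exact ⟨p ++ q, by simp [g, ← h2]⟩

lemma cf_sum (x : ℤ) (t : List ℤ) :
    ∑ k ∈ Finset.range (t.length + 2), (-1 : ℂ) ^ k * cf k (x :: t) = 0 := by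
  induction t generalizing x with
  | nil => simp [Finset.sum_range_succ, cf, indP]
  | cons y t ih =>
    rw [Finset.sum_range_succ']
    by_cases hxy : x > y
    · have h0 : cf 0 (x :: y :: t) = 0 := by
        simp [cf, indP, hxy]
      rw [h0]
      have h1 : ∀ k, cf (k + 1) (x :: y :: t) = cf k (y :: t) := by
        intro k
        cases k with
        | zero => simp [cf, indP]
        | succ k => simp [cf, indP, hxy]
      have := ih y
      simp only [h1, pow_succ, List.length_cons, mul_neg_one, neg_mul, Finset.sum_neg_distrib]
      rw [this]; simp
    · have h1 : ∀ k, cf (k + 2) (x :: y :: t) = 0 := by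
        intro k
        simp [cf, indP, hxy]
      rw [List.length_cons, Finset.sum_range_succ']
      simp only [add_assoc, Nat.reduceAdd, h1]
      simp [cf, indP, not_lt.1 hxy]
      split_ifs <;> simp

/-- `invTe` is the multiplicative mould inverse of `Te`:
`∑_{k=0}^r Te^{s₁,…,s_k}(z) · invTe^{s_{k+1},…,s_r}(z) = 0` for nonempty `s` with all `sᵢ ≥ 2`. -/
theorem invTe_mould_inverse
    (s : List ℕ) (hr : 1 ≤ s.length) (hs : ∀ x ∈ s, 2 ≤ x)
    (z : ℂ) (hz : ∀ n : ℤ, z ≠ (n : ℂ)) :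
    ∑ k ∈ Finset.range (s.length + 1), Te (s.take k) z * invTe (s.drop k) z = 0 := by
  have key : ∀ k ∈ Finset.range (s.length + 1), Te (s.take k) z * invTe (s.drop k) z =
      (-1) ^ s.length * ∑' l, ((-1) ^ k * cf k l) * mouldH z s l := by
    intro k hk
    have hk : k ≤ s.length := by simpa [Nat.lt_succ_iff] using hk
    rw [prod_list _ _ z (fun x hx => hs x (List.mem_of_mem_take hx))
      (fun x hx => hs x (List.mem_of_mem_drop hx)), List.take_append_drop]
    simp only [List.length_take, List.length_drop, min_eq_left hk, mul_assoc, tsum_mul_left]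
    rw [← mul_assoc]
    congr 1
    obtain ⟨m, hm⟩ := Nat.exists_eq_add_of_le hk
    rw [hm, Nat.add_sub_cancel_left, pow_add, mul_comm, ← mul_assoc, ← mul_pow]
    simp
  rw [Finset.sum_congr rfl key, ← Finset.mul_sum, ← Summable.tsum_finsetSum]
  · have : ∀ l, ∑ k ∈ Finset.range (s.length + 1), ((-1) ^ k * cf k l) * mouldH z s l = 0 := by
      intro l
      rw [← Finset.sum_mul]
      by_cases h : mouldH z s l = 0
      · simp [h]
      · have hl := mouldH_length z s l h
        cases l with
        | nil => simp at hl; omega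
        | cons x t =>
          rw [← hl, List.length_cons, cf_sum, zero_mul]
    simp [this]
  · intro k _
    refine (ind_summable z s hs (fun l => (-1) ^ k * cf k l) fun l => ?_).of_norm
    simpa using cf_norm k l
end

section
/- Factorization of multitangents: let r ≥ 1 and let (s_1,…,s_r) be positive integers with s_1 ≥ 2 and s_r ≥ 2. Then for every z ∈ ℂ ∖ ℤ, Te^{s_1,…,s_r}(z) = ∑_{k=0}^{r} Se₊^{s_1,…,s_k}(z) · invSe₋^{s_{k+1},…,s_r}(z), where for k = 0 and k = r the corresponding factor over the empty sequence equals 1. -/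
/-- `Se₊^{t₁,…,t_m}(z) = ∑_{n₁ > n₂ > ⋯ > n_m > 0} ∏ (nᵢ + z)^{-tᵢ}`; `Se₊^{∅}(z) = 1`. -/
noncomputable def SeP (t : List ℕ) (z : ℂ) : ℂ :=
  ∑' n : {n : Fin t.length → ℤ // StrictAnti n ∧ ∀ i, 0 < n i},
    ∏ i : Fin t.length, ((n.1 i : ℂ) + z) ^ (-(t.get i : ℤ))

/-- `invSe₋^{t₁,…,t_m}(z) = ∑_{0 ≥ n₁ > n₂ > ⋯ > n_m} ∏ (nᵢ + z)^{-tᵢ}`; `invSe₋^{∅}(z) = 1`. -/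
noncomputable def invSeM (t : List ℕ) (z : ℂ) : ℂ :=
  ∑' n : {n : Fin t.length → ℤ // StrictAnti n ∧ ∀ i, n i ≤ 0},
    ∏ i : Fin t.length, ((n.1 i : ℂ) + z) ^ (-(t.get i : ℤ))

theorem aux_summable_pi (g : ℤ → ℝ) (hg : ∀ n, 0 ≤ g n) (hs : Summable g) (m : ℕ) :
    Summable (fun n : Fin m → ℤ => ∏ i, g (n i)) := by
  induction m with
  | zero => exact (hasSum_fintype _).summable
  | succ m ih =>
    have h := hs.mul_of_nonneg ih hg (fun n => Finset.prod_nonneg fun i _ => hg _)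
    rw [← (Fin.consEquiv (fun _ : Fin (m+1) => ℤ)).summable_iff]
    refine h.congr ?_
    intro x
    simp [Fin.consEquiv, Fin.prod_univ_succ]

theorem aux_bound (z : ℂ) (hz : ∀ n : ℤ, z ≠ (n : ℂ)) :
    ∃ c : ℝ, 0 < c ∧ ∀ n : ℤ, 1 + |(n : ℝ)| ≤ c * ‖(n : ℂ) + z‖ := by
  have hcl : IsClosed (Set.range (fun n : ℤ => (n : ℂ))) := Complex.isClosed_range_intCast
  have hne : (Set.range (fun n : ℤ => (n : ℂ))).Nonempty := Set.range_nonempty _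
  have hnot : -z ∉ Set.range (fun n : ℤ => (n : ℂ)) := by
    rintro ⟨n, hn⟩
    apply hz (-n)
    push_cast
    simp only at hn
    rw [hn, neg_neg]
  have hd := (hcl.notMem_iff_infDist_pos hne).1 hnot
  set d := Metric.infDist (-z) (Set.range (fun n : ℤ => (n : ℂ)))
  have hdn : ∀ n : ℤ, d ≤ ‖(n : ℂ) + z‖ := by
    intro n
    have := Metric.infDist_le_dist_of_mem (x := -z) (Set.mem_range_self (f := fun n : ℤ => (n : ℂ)) n)
    rw [dist_comm, dist_eq_norm, sub_neg_eq_add] at this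
    exact this
  refine ⟨1 + (1 + ‖z‖) / d, by positivity, fun n => ?_⟩
  have h1 : |(n : ℝ)| ≤ ‖(n : ℂ) + z‖ + ‖z‖ := by
    have := norm_sub_le ((n : ℂ) + z) z
    rw [add_sub_cancel_right, Complex.norm_intCast] at this
    exact this
  have h2 : 1 + ‖z‖ ≤ (1 + ‖z‖) / d * ‖(n : ℂ) + z‖ := by
    rw [div_mul_eq_mul_div, le_div_iff₀ hd]
    exact mul_le_mul_of_nonneg_left (hdn n) (by positivity)
  linarith

theorem aux_int_summable (p : ℝ) (hp : 1 < p) :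
    Summable (fun n : ℤ => (1 + |(n : ℝ)|) ^ (-p)) := by
  have h : Summable (fun n : ℕ => (1 + |(n : ℝ)|) ^ (-p)) := by
    have := (summable_nat_add_iff 1).2 (Real.summable_nat_rpow (p := -p) |>.2 (by linarith))
    refine this.congr fun n => ?_
    push_cast
    rw [abs_of_nonneg (by positivity), add_comm]
  apply Summable.of_nat_of_neg
  · simpa using h
  · simpa using h

theorem aux_summable (z : ℂ) (hz : ∀ n : ℤ, z ≠ (n : ℂ)) (m : ℕ) (t : Fin m → ℕ)
    (ht : ∀ i, 1 ≤ t i) (j : Fin m) (hj : 2 ≤ t j) (P : (Fin m → ℤ) → Prop)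
    (hP : ∀ n, P n → ∀ i, |n i| ≤ |n j|) :
    Summable (fun n : {n : Fin m → ℤ // P n} =>
      ‖∏ i, ((n.1 i : ℂ) + z) ^ (-(t i : ℤ))‖) := by
  obtain ⟨c, hc, hb⟩ := aux_bound z hz
  have hm : 0 < m := j.pos
  have hm' : (0 : ℝ) < m := by exact_mod_cast hm
  have hsum := aux_summable_pi (fun n : ℤ => (1 + |(n : ℝ)|) ^ (-(1 + 1 / (m : ℝ))))
    (fun n => by positivity) (aux_int_summable _ (by linarith [show 0 < 1 / (m:ℝ) by positivity])) m
  have hsum2 := (hsum.mul_left (∏ i, c ^ (t i))).comp_injective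
    (Subtype.val_injective (p := P))
  refine Summable.of_nonneg_of_le (fun _ => norm_nonneg _) ?_ hsum2
  rintro ⟨n, hn⟩
  simp only [Function.comp]
  have hw : ∀ i, (1 : ℝ) ≤ 1 + |(n i : ℝ)| := fun i => by linarith [abs_nonneg (n i : ℝ)]
  have hw0 : ∀ i, (0 : ℝ) < 1 + |(n i : ℝ)| := fun i => by linarith [hw i]
  have hwj : ∀ i, 1 + |(n i : ℝ)| ≤ 1 + |(n j : ℝ)| := fun i => by
    have := hP n hn i
    have : ((|n i| : ℤ) : ℝ) ≤ ((|n j| : ℤ) : ℝ) := by exact_mod_cast this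
    push_cast at this
    linarith
  rw [norm_prod]
  have step1 : ∀ i, ‖((n i : ℂ) + z) ^ (-(t i : ℤ))‖ ≤
      c ^ (t i) * ((1 + |(n i : ℝ)|) ^ (t i))⁻¹ := by
    intro i
    rw [norm_zpow, zpow_neg, zpow_natCast]
    have h0 : 0 < ‖(n i : ℂ) + z‖ := by
      by_contra h
      have := hb (n i)
      nlinarith [hw i]
    rw [← div_eq_mul_inv, le_div_iff₀ (pow_pos (hw0 i) _), inv_mul_le_iff₀ (pow_pos h0 _),
      ← mul_pow, mul_comm]
    exact pow_le_pow_left₀ (hw0 i).le (hb _) _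
  have step2 : ∏ i, ((1 + |(n i : ℝ)|) ^ (t i))⁻¹ ≤
      ∏ i, (1 + |(n i : ℝ)|) ^ (-(1 + 1 / (m : ℝ))) := by
    have e1 : ∀ i, (1 + |(n i : ℝ)|) ^ (-(1 + 1 / (m : ℝ))) =
        ((1 + |(n i : ℝ)|) * (1 + |(n i : ℝ)|) ^ (1 / (m : ℝ)))⁻¹ := fun i => by
      rw [Real.rpow_neg (hw0 i).le, Real.rpow_add (hw0 i), Real.rpow_one]
    simp_rw [e1]
    rw [Finset.prod_inv_distrib, Finset.prod_inv_distrib]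
    apply inv_anti₀
    · exact Finset.prod_pos fun i _ => mul_pos (hw0 i) (Real.rpow_pos_of_pos (hw0 i) _)
    rw [Finset.prod_mul_distrib]
    have e2 : ∏ i, (1 + |(n i : ℝ)|) ^ (1 / (m : ℝ)) ≤ 1 + |(n j : ℝ)| := by
      calc ∏ i, (1 + |(n i : ℝ)|) ^ (1 / (m : ℝ)) ≤ ∏ i : Fin m, (1 + |(n j : ℝ)|) ^ (1 / (m : ℝ)) :=
            Finset.prod_le_prod (fun i _ => by positivity)
              (fun i _ => Real.rpow_le_rpow (hw0 i).le (hwj i) (by positivity))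
        _ = 1 + |(n j : ℝ)| := by
            rw [Finset.prod_const, Finset.card_univ, Fintype.card_fin, one_div,
              Real.rpow_inv_natCast_pow (hw0 j).le hm.ne']
    rw [← Finset.mul_prod_erase _ (fun i => 1 + |(n i : ℝ)|) (Finset.mem_univ j),
      ← Finset.mul_prod_erase _ (fun i => (1 + |(n i : ℝ)|) ^ (t i)) (Finset.mem_univ j)]
    have e3 : ∏ i ∈ Finset.univ.erase j, (1 + |(n i : ℝ)|) ≤
        ∏ i ∈ Finset.univ.erase j, (1 + |(n i : ℝ)|) ^ (t i) :=
      Finset.prod_le_prod (fun i _ => (hw0 i).le)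
        (fun i _ => le_self_pow₀ (hw i) (by have := ht i; omega))
    have e4 : (1 + |(n j : ℝ)|) ^ 2 ≤ (1 + |(n j : ℝ)|) ^ (t j) :=
      pow_le_pow_right₀ (hw j) hj
    have e5 : 0 ≤ ∏ i ∈ Finset.univ.erase j, (1 + |(n i : ℝ)|) :=
      Finset.prod_nonneg fun i _ => (hw0 i).le
    calc _ ≤ ((1 + |(n j : ℝ)|) * ∏ i ∈ Finset.univ.erase j, (1 + |(n i : ℝ)|)) *
          (1 + |(n j : ℝ)|) :=
          mul_le_mul_of_nonneg_left e2 (mul_nonneg (hw0 j).le e5)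
      _ = (1 + |(n j : ℝ)|) ^ 2 * ∏ i ∈ Finset.univ.erase j, (1 + |(n i : ℝ)|) := by ring
      _ ≤ _ := mul_le_mul e4 e3 e5 (by positivity)
  calc _ ≤ ∏ i, (c ^ (t i) * ((1 + |(n i : ℝ)|) ^ (t i))⁻¹) :=
        Finset.prod_le_prod (fun i _ => norm_nonneg _) (fun i _ => step1 i)
    _ = (∏ i, c ^ (t i)) * ∏ i, ((1 + |(n i : ℝ)|) ^ (t i))⁻¹ := Finset.prod_mul_distrib
    _ ≤ _ := mul_le_mul_of_nonneg_left step2 (Finset.prod_nonneg fun i _ => by positivity)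

theorem aux_sumP (z : ℂ) (hz : ∀ n : ℤ, z ≠ (n : ℂ)) (t : List ℕ) (ht : ∀ x ∈ t, 0 < x)
    (h1 : ∀ h : 0 < t.length, 2 ≤ t[0]) :
    Summable (fun n : {n : Fin t.length → ℤ // StrictAnti n ∧ ∀ i, 0 < n i} =>
      ‖∏ i : Fin t.length, ((n.1 i : ℂ) + z) ^ (-(t.get i : ℤ))‖) := by
  rcases Nat.eq_zero_or_pos t.length with h | h
  · have : IsEmpty (Fin t.length) := by rw [h]; infer_instance
    exact summable_of_hasFiniteSupport (Set.toFinite _)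
  · refine aux_summable z hz _ (fun i => t.get i) (fun i => ht _ (List.get_mem _ _)) ⟨0, h⟩
      (h1 h) _ ?_
    rintro n ⟨hn, hp⟩ i
    rw [abs_of_pos (hp _), abs_of_pos (hp _)]
    exact hn.antitone (Fin.mk_le_of_le_val (Nat.zero_le _))

theorem aux_sumM (z : ℂ) (hz : ∀ n : ℤ, z ≠ (n : ℂ)) (t : List ℕ) (ht : ∀ x ∈ t, 0 < x)
    (h1 : ∀ h : 0 < t.length, 2 ≤ t[t.length - 1]) :
    Summable (fun n : {n : Fin t.length → ℤ // StrictAnti n ∧ ∀ i, n i ≤ 0} =>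
      ‖∏ i : Fin t.length, ((n.1 i : ℂ) + z) ^ (-(t.get i : ℤ))‖) := by
  rcases Nat.eq_zero_or_pos t.length with h | h
  · have : IsEmpty (Fin t.length) := by rw [h]; infer_instance
    exact summable_of_hasFiniteSupport (Set.toFinite _)
  · refine aux_summable z hz _ (fun i => t.get i) (fun i => ht _ (List.get_mem _ _))
      ⟨t.length - 1, by omega⟩ (h1 h) _ ?_
    rintro n ⟨hn, hp⟩ i
    rw [abs_of_nonpos (hp _), abs_of_nonpos (hp _), neg_le_neg_iff]
    exact hn.antitone (Fin.le_def.2 (by have := i.2; simp only; omega))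

abbrev AuxA (t : List ℕ) := {n : Fin t.length → ℤ // StrictAnti n ∧ ∀ i, 0 < n i}
abbrev AuxB (t : List ℕ) := {n : Fin t.length → ℤ // StrictAnti n ∧ ∀ i, n i ≤ 0}

def auxGlue (s : List ℕ) (k : ℕ) (p : Fin (s.take k).length → ℤ)
    (q : Fin (s.drop k).length → ℤ) (i : Fin s.length) : ℤ :=
  if h : i.1 < k then p ⟨i.1, by have := i.2; rw [List.length_take]; omega⟩
  else q ⟨i.1 - k, by have := i.2; rw [List.length_drop]; omega⟩

theorem auxGlue_lt (s : List ℕ) (k : ℕ) (p q) (i : Fin s.length) (h : i.1 < k) :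
    auxGlue s k p q i = p ⟨i.1, by have := i.2; rw [List.length_take]; omega⟩ := by
  simp [auxGlue, h]

theorem auxGlue_ge (s : List ℕ) (k : ℕ) (p q) (i : Fin s.length) (h : ¬ i.1 < k) :
    auxGlue s k p q i = q ⟨i.1 - k, by have := i.2; rw [List.length_drop]; omega⟩ := by
  simp [auxGlue, h]

theorem auxGlue_anti (s : List ℕ) (k : ℕ) (p : AuxA (s.take k)) (q : AuxB (s.drop k)) :
    StrictAnti (auxGlue s k p.1 q.1) := by
  intro i j hij
  have hij' : i.1 < j.1 := hij
  by_cases hj : j.1 < k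
  · rw [auxGlue_lt _ _ _ _ _ hj, auxGlue_lt _ _ _ _ i (by omega)]
    exact p.2.1 hij'
  · rw [auxGlue_ge _ _ _ _ _ hj]
    by_cases hi : i.1 < k
    · rw [auxGlue_lt _ _ _ _ _ hi]
      exact lt_of_le_of_lt (q.2.2 _) (p.2.2 _)
    · rw [auxGlue_ge _ _ _ _ _ hi]
      exact q.2.1 (Fin.lt_def.2 (by simp only; omega))

theorem auxGlue_pos (s : List ℕ) (k : ℕ) (p : AuxA (s.take k)) (q : AuxB (s.drop k))
    (i : Fin s.length) : 0 < auxGlue s k p.1 q.1 i ↔ i.1 < k := by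
  by_cases hi : i.1 < k
  · rw [auxGlue_lt _ _ _ _ _ hi]
    exact ⟨fun _ => hi, fun _ => p.2.2 _⟩
  · rw [auxGlue_ge _ _ _ _ _ hi]
    exact ⟨fun h => absurd (q.2.2 _) (not_le.2 h), fun h => absurd h hi⟩

def auxMap (s : List ℕ) (x : Σ k : Fin (s.length + 1), AuxA (s.take k) × AuxB (s.drop k)) :
    {n : Fin s.length → ℤ // StrictAnti n} :=
  ⟨auxGlue s x.1 x.2.1.1 x.2.2.1, auxGlue_anti s x.1 x.2.1 x.2.2⟩

theorem auxMap_bij (s : List ℕ) : Function.Bijective (auxMap s) := by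
  constructor
  · rintro ⟨k, p, q⟩ ⟨k', p', q'⟩ h
    have h' : auxGlue s k p.1 q.1 = auxGlue s k' p'.1 q'.1 := congrArg Subtype.val h
    have hk : ∀ i : Fin s.length, i.1 < k.1 ↔ i.1 < k'.1 := fun i => by
      rw [← auxGlue_pos s k p q i, h', auxGlue_pos s k' p' q' i]
    have hkk : k = k' := by
      apply Fin.ext
      by_contra hne
      have a := k.2
      have b := k'.2
      rcases lt_or_gt_of_ne hne with hlt | hlt
      · have := hk ⟨k.1, by omega⟩
        simp only at this
        omega
      · have := hk ⟨k'.1, by omega⟩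
        simp only at this
        omega
    subst hkk
    have hp : p = p' := by
      apply Subtype.ext
      funext i
      have hi := lt_of_lt_of_eq i.2 List.length_take
      have := congrFun h' ⟨i.1, by omega⟩
      rwa [auxGlue_lt _ _ _ _ _ (by simp only; omega),
        auxGlue_lt _ _ _ _ _ (by simp only; omega)] at this
    have hq : q = q' := by
      apply Subtype.ext
      funext i
      have hi := lt_of_lt_of_eq i.2 List.length_drop
      have := congrFun h' ⟨i.1 + k.1, by omega⟩
      rw [auxGlue_ge _ _ _ _ _ (by simp only; omega),
        auxGlue_ge _ _ _ _ _ (by simp only; omega)] at this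
      simpa using this
    rw [hp, hq]
  · rintro ⟨n, hn⟩
    classical
    have hex : ∃ k : ℕ, ∀ i : Fin s.length, k ≤ i.1 → n i ≤ 0 :=
      ⟨s.length, fun i hi => absurd i.2 (not_lt.2 hi)⟩
    have hk1 := Nat.find_spec hex
    have hk2 : ∀ i : Fin s.length, i.1 < Nat.find hex → 0 < n i := by
      intro i hi
      have := Nat.find_min hex hi
      push Not at this
      obtain ⟨i', h1, h2⟩ := this
      exact lt_of_lt_of_le h2 (hn.antitone (Fin.le_def.2 h1))
    have hk3 : Nat.find hex < s.length + 1 :=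
      Nat.lt_succ_of_le (Nat.find_min' hex (fun i hi => absurd i.2 (not_lt.2 hi)))
    set k := Nat.find hex with hkdef
    refine ⟨⟨⟨k, hk3⟩,
      ⟨fun i => n ⟨i.1, by have := lt_of_lt_of_eq i.2 List.length_take; omega⟩, ?_, ?_⟩,
      ⟨fun i => n ⟨i.1 + k, by have := lt_of_lt_of_eq i.2 List.length_drop; simp only at this; omega⟩, ?_, ?_⟩⟩, ?_⟩
    · intro a b hab
      exact hn hab
    · intro i
      apply hk2
      have := lt_of_lt_of_eq i.2 List.length_take; simp only at this ⊢; omega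
    · intro a b hab
      exact hn (Fin.lt_def.2 (by have : a.1 < b.1 := hab; simp only; omega))
    · intro i
      apply hk1
      simp
    · apply Subtype.ext
      funext i
      simp only [auxMap]
      by_cases hi : i.1 < k
      · rw [auxGlue_lt _ _ _ _ _ hi]
      · rw [auxGlue_ge _ _ _ _ _ hi]
        congr 1
        apply Fin.ext
        simp only
        omega

theorem auxProd (s : List ℕ) (k : ℕ) (hk : k ≤ s.length) (p : Fin (s.take k).length → ℤ)
    (q : Fin (s.drop k).length → ℤ) (z : ℂ) :
    ∏ i : Fin s.length, ((auxGlue s k p q i : ℂ) + z) ^ (-(s.get i : ℤ)) =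
    (∏ i : Fin (s.take k).length, ((p i : ℂ) + z) ^ (-((s.take k).get i : ℤ))) *
    ∏ i : Fin (s.drop k).length, ((q i : ℂ) + z) ^ (-((s.drop k).get i : ℤ)) := by
  have hlen : (s.take k).length + (s.drop k).length = s.length := by
    rw [List.length_take, List.length_drop]; omega
  have hk' : (s.take k).length = k := by rw [List.length_take]; omega
  rw [← (finCongr hlen).prod_comp, Fin.prod_univ_add]
  congr 1
  · refine Finset.prod_congr rfl fun i _ => ?_
    have hi := i.2
    rw [auxGlue_lt _ _ _ _ _ (by simp; omega)]
    simp
  · refine Finset.prod_congr rfl fun i _ => ?_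
    have hi := i.2
    rw [auxGlue_ge _ _ _ _ _ (by simp; omega)]
    have e : ∀ h, (⟨((finCongr hlen) (Fin.natAdd (s.take k).length i)).1 - k, h⟩ :
        Fin (s.drop k).length) = i := by
      intro h
      apply Fin.ext
      simp [hk]
    rw [e]
    simp [hk]

/-- Factorization of multitangents: `Te^{s}(z) = ∑_{k=0}^{r} Se₊^{s₁,…,s_k}(z) ·
invSe₋^{s_{k+1},…,s_r}(z)`. -/
theorem multitangent_factorization
    (s : List ℕ) (hr : 1 ≤ s.length) (hpos : ∀ x ∈ s, 0 < x)
    (hfirst : 2 ≤ s.headI) (hlast : 2 ≤ s.getLast!)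
    (z : ℂ) (hz : ∀ n : ℤ, z ≠ (n : ℂ)) :
    Te s z = ∑ k ∈ Finset.range (s.length + 1), SeP (s.take k) z * invSeM (s.drop k) z := by
  have hne : s ≠ [] := by
    rintro rfl
    simp at hr
  have hf : 2 ≤ s[0] := by
    cases s with
    | nil => exact absurd rfl hne
    | cons a l => simpa using hfirst
  have hl : 2 ≤ s[s.length - 1] := by
    rw [List.getLast!_eq_getLast?_getD, List.getLast?_eq_getLast_of_ne_nil hne] at hlast
    simpa [List.getLast_eq_getElem] using hlast
  have hA : ∀ k, Summable (fun n : AuxA (s.take k) =>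
      ‖∏ i : Fin (s.take k).length, ((n.1 i : ℂ) + z) ^ (-((s.take k).get i : ℤ))‖) := fun k =>
    aux_sumP z hz _ (fun x hx => hpos x (List.mem_of_mem_take hx)) (fun h => by simpa using hf)
  have hB : ∀ k, Summable (fun n : AuxB (s.drop k) =>
      ‖∏ i : Fin (s.drop k).length, ((n.1 i : ℂ) + z) ^ (-((s.drop k).get i : ℤ))‖) := fun k =>
    aux_sumM z hz _ (fun x hx => hpos x (List.mem_of_mem_drop hx)) (fun h => by
      have h' := h
      rw [List.length_drop] at h'
      have : k + (s.length - k - 1) = s.length - 1 := by omega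
      simpa [this] using hl)
  let F : (Σ k : Fin (s.length + 1), AuxA (s.take k) × AuxB (s.drop k)) → ℂ := fun x =>
    (∏ i : Fin (s.take x.1).length, ((x.2.1.1 i : ℂ) + z) ^ (-((s.take x.1).get i : ℤ))) *
    ∏ i : Fin (s.drop x.1).length, ((x.2.2.1 i : ℂ) + z) ^ (-((s.drop x.1).get i : ℤ))
  have hTe : Te s z = ∑' x, F x := by
    unfold Te
    rw [← (Equiv.ofBijective _ (auxMap_bij s)).tsum_eq]
    refine tsum_congr fun x => ?_
    exact auxProd s x.1 (Nat.le_of_lt_succ x.1.2) _ _ z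
  have hF : Summable F := by
    apply Summable.of_norm
    rw [summable_sigma_of_nonneg (fun _ => norm_nonneg _)]
    refine ⟨fun k => ?_, summable_of_hasFiniteSupport (Set.toFinite _)⟩
    exact Summable.mul_norm (f := fun n : AuxA (s.take k) =>
      ∏ i : Fin (s.take k).length, ((n.1 i : ℂ) + z) ^ (-((s.take k).get i : ℤ)))
      (g := fun n : AuxB (s.drop k) =>
      ∏ i : Fin (s.drop k).length, ((n.1 i : ℂ) + z) ^ (-((s.drop k).get i : ℤ))) (hA k) (hB k)
  rw [hTe, hF.tsum_sigma, tsum_fintype, Finset.sum_range]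
  refine Finset.sum_congr rfl fun k _ => ?_
  exact (tsum_mul_tsum_of_summable_norm (hA k) (hB k)).symm
end

section
/- The symmetral multizetas Za are symmetral: let s′ = (s′_1,…,s′_p) and s″ = (s″_1,…,s″_q) be nonempty sequences of positive integers with s′_1 ≥ 2 and s″_1 ≥ 2. Then Za^{s′} · Za^{s″} = ∑_{w ∈ sha(s′,s″)} Za^{w}, the sum (with multiplicity) running over the multiset sha(s′,s″) of plain shuffles of s′ and s″. -/
open scoped Classical

/-- Symmetral multizeta value:
`Za^{s₁,…,s_r} = ∑_{n₁ ≥ n₂ ≥ ⋯ ≥ n_r > 0} (∏ nᵢ^{-sᵢ}) / (r₁! ⋯ r_t!)`, where the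
non-increasing tuple `(n₁,…,n_r)` consists of `t` maximal clusters of equal integers of sizes
`r₁,…,r_t` (these sizes are the multiplicities of the distinct values); `Za^{∅} = 1`. -/
noncomputable def Za (s : List ℕ) : ℝ :=
  ∑' n : {n : Fin s.length → ℕ // Antitone n ∧ ∀ i, 0 < n i},
    (∏ i : Fin s.length, ((n.1 i : ℝ)) ^ (-(s.get i : ℤ))) *
      (1 / ∏ v ∈ Finset.image n.1 Finset.univ,
        ((Finset.univ.filter (fun i => n.1 i = v)).card.factorial : ℝ))

/-- The multiset of plain shuffles of two sequences: all interleavings preserving the internal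
order of each sequence. -/
def sha : List ℕ → List ℕ → Multiset (List ℕ)
  | [], t => {t}
  | a :: s, [] => {a :: s}
  | a :: s, b :: t =>
      ((sha s (b :: t)).map (a :: ·)) + ((sha (a :: s) t).map (b :: ·))
termination_by s t => s.length + t.length

noncomputable def Sh (F : List ℕ → ℝ) (s t : List ℕ) : ℝ := ((sha s t).map F).sum

noncomputable def mmul (A B : List ℕ → ℝ) (s : List ℕ) : ℝ :=
  ∑ k ∈ Finset.range (s.length + 1), A (s.take k) * B (s.drop k)

lemma Sh_nil_left (F : List ℕ → ℝ) (t : List ℕ) : Sh F [] t = F t := by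
  simp [Sh, sha]

lemma Sh_nil_right (F : List ℕ → ℝ) (t : List ℕ) : Sh F t [] = F t := by
  cases t <;> simp [Sh, sha]

lemma Sh_cons (F : List ℕ → ℝ) (a b : ℕ) (s t : List ℕ) :
    Sh F (a :: s) (b :: t) =
      Sh (fun w => F (a :: w)) s (b :: t) + Sh (fun w => F (b :: w)) (a :: s) t := by
  simp [Sh, sha]

lemma Sh_add (c : ℝ) (F H : List ℕ → ℝ) (s t : List ℕ) :
    Sh (fun w => c * F w + H w) s t = c * Sh F s t + Sh H s t := by
  simp [Sh, Multiset.sum_map_add, Multiset.sum_map_mul_left]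

lemma mmul_cons (A B : List ℕ → ℝ) (a : ℕ) (s : List ℕ) :
    mmul A B (a :: s) = A [] * B (a :: s) + mmul (fun w => A (a :: w)) B s := by
  simp only [mmul, List.length_cons]
  rw [Finset.sum_range_succ']
  simp [add_comm]

lemma Sh_mmul (s t : List ℕ) : ∀ (A B : List ℕ → ℝ),
    Sh (mmul A B) s t = ∑ k ∈ Finset.range (s.length + 1), ∑ l ∈ Finset.range (t.length + 1),
      Sh A (s.take k) (t.take l) * Sh B (s.drop k) (t.drop l) := by
  match s, t with
  | [], t => intro A B; simp [Sh_nil_left, mmul]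
  | a :: s, [] => intro A B; simp [Sh_nil_right, mmul]
  | a :: s, b :: t =>
    intro A B
    rw [Sh_cons]
    simp only [mmul_cons]
    rw [Sh_add, Sh_add, Sh_mmul s (b :: t), Sh_mmul (a :: s) t]
    simp only [List.length_cons]
    rw [Finset.sum_range_succ' _ (s.length + 1), Finset.sum_range_succ' _ (s.length + 1)]
    simp only [Finset.sum_range_succ' _ (t.length + 1), List.take_succ_cons, List.drop_succ_cons,
      List.take_zero, List.drop_zero, Sh_cons, Sh_nil_left, Sh_nil_right, add_mul,
      Finset.sum_add_distrib]
    ring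
termination_by s.length + t.length

lemma sha_perm (s t : List ℕ) : ∀ w ∈ sha s t, w.Perm (s ++ t) := by
  match s, t with
  | [], t => intro w hw; simp [sha] at hw; simp [hw]
  | a :: s, [] => intro w hw; simp [sha] at hw; simp [hw]
  | a :: s, b :: t =>
    intro w hw
    simp only [sha, Multiset.mem_add, Multiset.mem_map] at hw
    rcases hw with ⟨v, hv, rfl⟩ | ⟨v, hv, rfl⟩
    · simpa using sha_perm s (b :: t) v hv
    · have := sha_perm (a :: s) t v hv
      exact (this.cons b).trans (List.perm_middle.symm)
termination_by s.length + t.length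

lemma sha_card (s t : List ℕ) :
    (sha s t).card = (s.length + t.length).choose s.length := by
  match s, t with
  | [], t => simp [sha]
  | a :: s, [] => simp [sha]
  | a :: s, b :: t =>
    simp only [sha, Multiset.card_add, Multiset.card_map]
    rw [sha_card s (b :: t), sha_card (a :: s) t]
    simp only [List.length_cons]
    rw [show s.length + 1 + (t.length + 1) = (s.length + (t.length + 1)) + 1 by ring,
      Nat.choose_succ_succ]
    congr 2
    ring
termination_by s.length + t.length

lemma sha_head (s t : List ℕ) (hs : s ≠ []) (ht : t ≠ []) (h1 : 2 ≤ s.headI) (h2 : 2 ≤ t.headI) :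
    ∀ w ∈ sha s t, 2 ≤ w.headI := by
  match s, t with
  | [], t => simp at hs
  | a :: s, [] => simp at ht
  | a :: s, b :: t =>
    intro w hw
    simp only [sha, Multiset.mem_add, Multiset.mem_map] at hw
    rcases hw with ⟨v, hv, rfl⟩ | ⟨v, hv, rfl⟩
    · simpa using h1
    · simpa using h2

noncomputable def EE (x : ℝ) (s : List ℕ) : ℝ := x ^ (-(s.sum : ℤ)) / (s.length.factorial : ℝ)

lemma Sh_EE (x : ℝ) (hx : x ≠ 0) (s t : List ℕ) : Sh (EE x) s t = EE x s * EE x t := by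
  have h : (sha s t).map (EE x) = (sha s t).map (fun _ => EE x (s ++ t)) := by
    apply Multiset.map_congr rfl
    intro w hw
    have := sha_perm s t w hw
    simp only [EE]
    rw [this.sum_eq, this.length_eq]
  rw [Sh, h, Multiset.map_const', Multiset.sum_replicate, sha_card, nsmul_eq_mul]
  simp only [EE, List.sum_append, List.length_append]
  rw [Nat.cast_add_choose]
  have h3 := Nat.cast_ne_zero (R := ℝ).2 (Nat.factorial_ne_zero (s.length + t.length))
  have h4 : x ^ (-((s.sum + t.sum : ℕ) : ℤ)) = x ^ (-(s.sum : ℤ)) * x ^ (-(t.sum : ℤ)) := by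
    rw [← zpow_add₀ hx]; congr 1; push_cast; ring
  rw [h4]
  field_simp

noncomputable def wt {r : ℕ} (e : ℕ → ℕ) (n : Fin r → ℕ) : ℝ :=
  (∏ i : Fin r, ((n i : ℝ)) ^ (-(e i : ℤ))) *
      (1 / ∏ v ∈ Finset.image n Finset.univ,
        ((Finset.univ.filter (fun i => n i = v)).card.factorial : ℝ))

def SS (N r : ℕ) : Finset (Fin r → ℕ) :=
  (Fintype.piFinset (fun _ : Fin r => Finset.Icc 1 N)).filter Antitone

lemma mem_SS {N r : ℕ} {n : Fin r → ℕ} : n ∈ SS N r ↔ (∀ i, 1 ≤ n i ∧ n i ≤ N) ∧ Antitone n := by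
  simp [SS]

noncomputable def Zf (N r : ℕ) (e : ℕ → ℕ) : ℝ := ∑ n ∈ SS N r, wt e n

lemma wt_eq {N r : ℕ} (e : ℕ → ℕ) (n : Fin r → ℕ) (h : ∀ i, n i ≤ N) :
    wt e n = (∏ i : Fin r, ((n i : ℝ)) ^ (-(e i : ℤ))) *
      (1 / ∏ v ∈ Finset.range (N + 1),
        ((∑ i, if n i = v then 1 else 0 : ℕ).factorial : ℝ)) := by
  unfold wt
  congr 2
  simp only [Finset.card_filter]
  apply Finset.prod_subset
  · intro v hv
    simp only [Finset.mem_image, Finset.mem_univ, true_and] at hv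
    obtain ⟨i, rfl⟩ := hv
    simpa using Nat.lt_succ_of_le (h i)
  · intro v _ hv
    rw [Finset.sum_eq_zero]
    · simp
    · intro i _
      rw [if_neg]
      rintro rfl
      exact hv (Finset.mem_image_of_mem _ (Finset.mem_univ _))

lemma lower_card {r : ℕ} (A : Finset (Fin r)) (hA : ∀ i ∈ A, ∀ j ≤ i, j ∈ A) (i : Fin r) :
    i ∈ A ↔ (i : ℕ) < A.card := by
  constructor
  · intro hi
    have : Finset.Iic i ⊆ A := fun j hj => hA i hi j (Finset.mem_Iic.1 hj)
    have := Finset.card_le_card this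
    rw [Fin.card_Iic] at this
    omega
  · intro hi
    by_contra hn
    have : A ⊆ Finset.Iio i := by
      intro j hj
      rw [Finset.mem_Iio]
      by_contra hij
      exact hn (hA j hj i (not_lt.1 hij))
    have := Finset.card_le_card this
    rw [Fin.card_Iio] at this
    omega

lemma wt_append {N k m : ℕ} (e : ℕ → ℕ) (n : Fin m → ℕ) (h : ∀ i, n i ≤ N) :
    wt e (Fin.append (fun _ : Fin k => N + 1) n) =
      ((N + 1 : ℕ) : ℝ) ^ (-((∑ i ∈ Finset.range k, e i : ℕ) : ℤ)) / (k.factorial : ℝ) *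
        wt (fun i => e (k + i)) n := by
  rw [wt_eq (N := N + 1), wt_eq (N := N) _ n h]
  · rw [Finset.prod_range_succ]
    simp only [Fin.prod_univ_add, Fin.sum_univ_add, Fin.append_left, Fin.append_right]
    have h1 : ∀ i, n i ≠ N + 1 := fun i => by have := h i; omega
    have h2 : ∏ v ∈ Finset.range (N + 1),
        (((∑ i : Fin k, if N + 1 = v then 1 else 0) + ∑ i, if n i = v then 1 else 0 : ℕ).factorial : ℝ)
        = ∏ v ∈ Finset.range (N + 1), ((∑ i, if n i = v then 1 else 0 : ℕ).factorial : ℝ) := by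
      apply Finset.prod_congr rfl
      intro v hv
      have : N + 1 ≠ v := by have := Finset.mem_range.1 hv; omega
      simp [this]
    rw [h2]
    have h3 : ∏ i : Fin k, (((N + 1 : ℕ) : ℝ)) ^ (-(e (Fin.castAdd m i : Fin (k + m)) : ℤ))
        = ((N + 1 : ℕ) : ℝ) ^ (-((∑ i ∈ Finset.range k, e i : ℕ) : ℤ)) := by
      simp only [Fin.val_castAdd, zpow_neg, zpow_natCast, Finset.prod_inv_distrib]
      rw [Finset.prod_pow_eq_pow_sum, Fin.sum_univ_eq_sum_range]
    rw [h3]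
    simp only [h1, if_true, if_false, Finset.sum_const, Finset.card_univ, Fintype.card_fin,
      smul_eq_mul, mul_one, mul_zero, add_zero, Fin.val_natAdd]
    field_simp
  · intro i
    refine Fin.addCases (fun j => ?_) (fun j => ?_) i
    · simp
    · have := h j
      simp; omega

lemma Zf_succ (N r : ℕ) (e : ℕ → ℕ) :
    Zf (N + 1) r e = ∑ k ∈ Finset.range (r + 1),
      ((N + 1 : ℕ) : ℝ) ^ (-((∑ i ∈ Finset.range k, e i : ℕ) : ℤ)) / (k.factorial : ℝ) *
        Zf N (r - k) (fun i => e (k + i)) := by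
  unfold Zf
  rw [← Finset.sum_fiberwise_of_maps_to (s := SS (N + 1) r) (t := Finset.range (r + 1))
    (g := fun n => (Finset.univ.filter (fun i => n i = N + 1)).card)]
  swap
  · intro n _
    have := Finset.card_le_univ (Finset.univ.filter (fun i => n i = N + 1))
    simp at this ⊢
    omega
  apply Finset.sum_congr rfl
  intro k hk
  obtain ⟨m, rfl⟩ : ∃ m, r = k + m := ⟨r - k, by have := Finset.mem_range.1 hk; omega⟩
  rw [Nat.add_sub_cancel_left, Finset.mul_sum]
  symm
  refine Finset.sum_bij (fun n _ => Fin.append (fun _ : Fin k => N + 1) n) ?_ ?_ ?_ ?_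
  · intro n hn
    rw [mem_SS] at hn
    rw [Finset.mem_filter, mem_SS]
    have h1 : ∀ i, n i ≠ N + 1 := fun i => by have := (hn.1 i).2; omega
    refine ⟨⟨?_, ?_⟩, ?_⟩
    · intro i
      refine Fin.addCases (fun j => ?_) (fun j => ?_) i
      · simp
      · have := hn.1 j
        simp; omega
    · intro i j
      refine Fin.addCases (fun i => ?_) (fun i => ?_) i <;>
      refine Fin.addCases (fun j => ?_) (fun j => ?_) j
      · simp
      · intro _
        have := hn.1 j
        simp; omega
      · intro h
        simp [Fin.le_def] at h
        omega
      · intro h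
        simp only [Fin.append_right]
        refine hn.2 ?_
        rw [Fin.le_def] at h ⊢
        simp only [Fin.val_natAdd] at h
        omega
    · rw [Finset.card_filter, Fin.sum_univ_add]
      simp only [Fin.append_left, Fin.append_right, h1, if_true, if_false]
      simp
  · intro a _ b _ hab
    funext i
    have := congrFun hab (Fin.natAdd k i)
    simpa using this
  · intro n hn
    rw [Finset.mem_filter, mem_SS] at hn
    obtain ⟨⟨hn1, hn2⟩, hn3⟩ := hn
    have hl : ∀ i, n i = N + 1 ↔ (i : ℕ) < k := by
      intro i
      have key := lower_card (Finset.univ.filter (fun i => n i = N + 1)) ?_ i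
      · rw [hn3] at key
        simpa using key
      · intro i hi j hj
        simp only [Finset.mem_filter, Finset.mem_univ, true_and] at hi ⊢
        have := hn2 hj
        have := (hn1 j).2
        omega
    refine ⟨fun i => n (Fin.natAdd k i), ?_, ?_⟩
    · rw [mem_SS]
      refine ⟨fun i => ⟨(hn1 _).1, ?_⟩, ?_⟩
      · have h1 := (hn1 (Fin.natAdd k i)).2
        have h2 := (hl (Fin.natAdd k i)).not.2 (by simp)
        omega
      · intro i j hij
        refine hn2 ?_
        rw [Fin.le_def] at hij ⊢
        simp only [Fin.val_natAdd]
        omega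
    · funext i
      refine Fin.addCases (fun j => ?_) (fun j => ?_) i
      · simp only [Fin.append_left]
        exact ((hl _).2 (by simp)).symm
      · simp
  · intro n hn
    rw [mem_SS] at hn
    rw [wt_append e n (fun i => (hn.1 i).2)]

noncomputable def GG (N : ℕ) (s : List ℕ) : ℝ := Zf N s.length (fun i => s.getD i 0)

lemma GG_zero_nil (N : ℕ) : GG N [] = 1 := by
  have : SS N 0 = Finset.univ := by
    ext n; simpa [mem_SS, Subsingleton.antitone] using Subsingleton.elim _ _
  simp [GG, Zf, this, wt]

lemma GG_zero_cons (a : ℕ) (s : List ℕ) : GG 0 (a :: s) = 0 := by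
  apply Finset.sum_eq_zero
  intro n hn
  have := (mem_SS.1 hn).1 ⟨0, by simp⟩
  omega

lemma sum_getD (s : List ℕ) : ∀ k, ∑ i ∈ Finset.range k, s.getD i 0 = (s.take k).sum := by
  induction s with
  | nil => intro k; simp
  | cons a s ih =>
    intro k
    cases k with
    | zero => simp
    | succ k =>
      rw [Finset.sum_range_succ']
      simp only [List.getD_cons_succ, List.getD_cons_zero, List.take_succ_cons, List.sum_cons]
      rw [ih]; ring

lemma GG_succ (N : ℕ) (s : List ℕ) : GG (N + 1) s = mmul (EE ((N + 1 : ℕ) : ℝ)) (GG N) s := by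
  rw [GG, Zf_succ, mmul]
  apply Finset.sum_congr rfl
  intro k hk
  have hk' : k ≤ s.length := by have := Finset.mem_range.1 hk; omega
  rw [sum_getD, EE, GG, List.length_drop, List.length_take, min_eq_left hk']
  congr 3
  funext i
  simp [List.getD_eq_getElem?_getD, List.getElem?_drop]

lemma GG_symmetral (N : ℕ) : ∀ s t, Sh (GG N) s t = GG N s * GG N t := by
  induction N with
  | zero =>
    intro s t
    match s, t with
    | [], t => rw [Sh_nil_left, GG_zero_nil, one_mul]
    | a :: s, [] => rw [Sh_nil_right, GG_zero_nil, mul_one]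
    | a :: s, b :: t =>
      rw [Sh_cons]
      simp [GG_zero_cons, Sh]
  | succ N ih =>
    intro s t
    have : GG (N + 1) = mmul (EE ((N + 1 : ℕ) : ℝ)) (GG N) := funext (GG_succ N)
    rw [this, Sh_mmul]
    simp only [ih, Sh_EE _ (Nat.cast_ne_zero.2 (Nat.succ_ne_zero N))]
    simp only [mmul, Finset.sum_mul_sum]
    refine Finset.sum_congr rfl fun k _ => Finset.sum_congr rfl fun l _ => ?_
    ring

lemma summable_pi_prod (r : ℕ) (f : ℕ → ℝ) (hf : ∀ n, 0 ≤ f n) (hs : Summable f) :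
    Summable (fun n : Fin r → ℕ => ∏ i, f (n i)) := by
  apply summable_of_sum_le (c := ∏ _i : Fin r, ∑' n, f n)
  · intro n; exact Finset.prod_nonneg fun i _ => hf _
  · intro u
    have hu : u ⊆ Fintype.piFinset (fun i : Fin r => u.image (fun n => n i)) := by
      intro n hn
      rw [Fintype.mem_piFinset]
      intro i
      exact Finset.mem_image_of_mem (fun n : Fin r → ℕ => n i) hn
    calc _ ≤ ∑ n ∈ Fintype.piFinset (fun i : Fin r => u.image (fun n => n i)), ∏ i, f (n i) :=
          Finset.sum_le_sum_of_subset_of_nonneg hu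
            fun n _ _ => Finset.prod_nonneg fun i _ => hf _
      _ = ∏ i : Fin r, ∑ j ∈ u.image (fun n => n i), f j := by
          rw [Finset.prod_univ_sum]
      _ ≤ _ := Finset.prod_le_prod (fun i _ => Finset.sum_nonneg fun _ _ => hf _)
          fun i _ => hs.sum_le_tsum _ fun _ _ => hf _

lemma wt_nonneg {r : ℕ} (e : ℕ → ℕ) (n : Fin r → ℕ) : 0 ≤ wt e n := by
  unfold wt; positivity

lemma wt_le {r : ℕ} (e : ℕ → ℕ) (n : Fin (r + 1) → ℕ) (hn : Antitone n) (hp : ∀ i, 0 < n i)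
    (he : ∀ i < r + 1, 1 ≤ e i) (h0 : 2 ≤ e 0) :
    wt e n ≤ ∏ i, (1 / (n i : ℝ) ^ (1 + 1 / ((r : ℝ) + 1))) := by
  have hp' : ∀ i, (1 : ℝ) ≤ n i := fun i => by exact_mod_cast hp i
  have hp0 : ∀ i, (0 : ℝ) < n i := fun i => by exact_mod_cast hp i
  have h1 : wt e n ≤ ∏ i : Fin (r + 1), ((n i : ℝ)) ^ (-(e i : ℤ)) := by
    unfold wt
    apply mul_le_of_le_one_right
    · positivity
    · rw [div_le_one (by positivity)]
      exact_mod_cast Finset.one_le_prod' fun v _ => Nat.one_le_iff_ne_zero.2 (Nat.factorial_ne_zero _)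
  refine h1.trans ?_
  have h2 : ∏ i : Fin (r + 1), ((n i : ℝ)) ^ (-(e i : ℤ)) = (∏ i : Fin (r + 1), (n i : ℝ) ^ (e i))⁻¹ := by
    simp [zpow_neg, Finset.prod_inv_distrib]
  have h3 : ∏ i, (1 / (n i : ℝ) ^ (1 + 1 / ((r : ℝ) + 1))) = (∏ i, (n i : ℝ) ^ (1 + 1 / ((r : ℝ) + 1)))⁻¹ := by
    simp [Finset.prod_inv_distrib]
  rw [h2, h3]
  apply inv_anti₀ (Finset.prod_pos fun i _ => Real.rpow_pos_of_pos (hp0 i) _)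
  have h4 : ∏ i, (n i : ℝ) ^ (1 + 1 / ((r : ℝ) + 1)) = (∏ i, (n i : ℝ)) * ∏ i, (n i : ℝ) ^ (1 / ((r : ℝ) + 1)) := by
    rw [← Finset.prod_mul_distrib]
    refine Finset.prod_congr rfl fun i _ => ?_
    rw [Real.rpow_add (hp0 i), Real.rpow_one]
  have h5 : ∏ i, (n i : ℝ) ^ (1 / ((r : ℝ) + 1)) ≤ n 0 := by
    calc _ ≤ ∏ i : Fin (r + 1), (n 0 : ℝ) ^ (1 / ((r : ℝ) + 1)) := by
          refine Finset.prod_le_prod (fun i _ => by positivity) fun i _ => ?_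
          apply Real.rpow_le_rpow (hp0 i).le _ (by positivity)
          exact_mod_cast hn (Fin.zero_le i)
      _ = n 0 := by
          rw [Finset.prod_const, Finset.card_univ, Fintype.card_fin, ← Real.rpow_natCast,
            ← Real.rpow_mul (hp0 0).le]
          push_cast
          rw [one_div, inv_mul_cancel₀ (by positivity), Real.rpow_one]
  rw [h4]
  calc _ ≤ (∏ i, (n i : ℝ)) * n 0 := by gcongr
    _ ≤ _ := by
      rw [Fin.prod_univ_succ, Fin.prod_univ_succ]
      have h6 : ∏ i : Fin r, (n i.succ : ℝ) ≤ ∏ i : Fin r, (n i.succ : ℝ) ^ (e (i.succ : Fin (r + 1))) := by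
        refine Finset.prod_le_prod (fun i _ => by positivity) fun i _ => ?_
        exact le_self_pow₀ (hp' _) (Nat.one_le_iff_ne_zero.1 (he _ i.succ.2))
      have h7 : (n 0 : ℝ) * n 0 ≤ (n 0 : ℝ) ^ (e (0 : Fin (r + 1))) := by
        rw [← sq]
        exact pow_le_pow_right₀ (hp' 0) h0
      calc _ = ((n 0 : ℝ) * n 0) * ∏ i : Fin r, (n i.succ : ℝ) := by ring
        _ ≤ _ := by gcongr

lemma summable_wt {r : ℕ} (e : ℕ → ℕ) (he : ∀ i < r, 1 ≤ e i) (h0 : 0 < r → 2 ≤ e 0) :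
    Summable (fun n : {n : Fin r → ℕ // Antitone n ∧ ∀ i, 0 < n i} => wt e n.1) := by
  cases r with
  | zero => exact Summable.of_finite
  | succ r =>
    have hs : Summable (fun n : ℕ => 1 / (n : ℝ) ^ (1 + 1 / ((r : ℝ) + 1))) := by
      rw [Real.summable_one_div_nat_rpow]
      have : 0 < 1 / ((r : ℝ) + 1) := by positivity
      linarith
    have := (summable_pi_prod (r + 1) _ (fun n => by positivity) hs)
    refine Summable.of_nonneg_of_le (fun n => wt_nonneg _ _)
      (fun n => wt_le e n.1 n.2.1 n.2.2 he (h0 (Nat.succ_pos r))) (this.comp_injective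
        (i := fun n : {n : Fin (r + 1) → ℕ // Antitone n ∧ ∀ i, 0 < n i} => n.1) Subtype.val_injective)

lemma GG_tendsto (s : List ℕ) (hp : ∀ x ∈ s, 0 < x) (h0 : s ≠ [] → 2 ≤ s.headI) :
    Filter.Tendsto (fun N => GG N s) Filter.atTop (nhds (Za s)) := by
  have hZ : Za s = ∑' n : {n : Fin s.length → ℕ // Antitone n ∧ ∀ i, 0 < n i},
      wt (fun i => s.getD i 0) n.1 := by
    unfold Za wt
    refine tsum_congr fun n => ?_
    congr 1
    refine Finset.prod_congr rfl fun i _ => ?_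
    simp
  have hsum := summable_wt (r := s.length) (fun i => s.getD i 0)
    (by
      intro i hi
      simp only [List.getD_eq_getElem _ _ hi]
      exact hp _ (List.getElem_mem hi))
    (by
      intro h
      cases s with
      | nil => simp at h
      | cons a s => simpa using h0 (by simp))
  rw [hZ]
  have hG : ∀ N, GG N s = ∑ n ∈ (SS N s.length).subtype (fun n => Antitone n ∧ ∀ i, 0 < n i),
      wt (fun i => s.getD i 0) n.1 := by
    intro N
    rw [GG, Zf]
    rw [Finset.sum_subtype_of_mem (fun n => wt (fun i => s.getD i 0) n)]
    intro n hn
    rw [mem_SS] at hn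
    exact ⟨hn.2, fun i => (hn.1 i).1⟩
  simp only [hG]
  refine hsum.hasSum.comp ?_
  apply Filter.tendsto_atTop_finset_of_monotone
  · intro N M hNM n hn
    rw [Finset.mem_subtype, mem_SS] at hn ⊢
    exact ⟨fun i => ⟨(hn.1 i).1, (hn.1 i).2.trans hNM⟩, hn.2⟩
  · intro n
    refine ⟨∑ i, n.1 i, ?_⟩
    rw [Finset.mem_subtype, mem_SS]
    exact ⟨fun i => ⟨n.2.2 i, Finset.single_le_sum (f := n.1) (fun _ _ => Nat.zero_le _) (Finset.mem_univ i)⟩, n.2.1⟩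

lemma tendsto_multiset (m : Multiset (List ℕ))
    (h : ∀ w ∈ m, Filter.Tendsto (fun N => GG N w) Filter.atTop (nhds (Za w))) :
    Filter.Tendsto (fun N => (m.map (GG N)).sum) Filter.atTop (nhds (m.map Za).sum) :=
  tendsto_multiset_sum m h

/-- The symmetral multizetas `Za` are symmetral. -/
theorem Za_symmetral
    (s' s'' : List ℕ) (h' : s' ≠ []) (h'' : s'' ≠ [])
    (hpos' : ∀ x ∈ s', 0 < x) (hpos'' : ∀ x ∈ s'', 0 < x)
    (hfirst' : 2 ≤ s'.headI) (hfirst'' : 2 ≤ s''.headI) :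
    Za s' * Za s'' = ((sha s' s'').map Za).sum := by
  have h1 := (GG_tendsto s' hpos' fun _ => hfirst').mul (GG_tendsto s'' hpos'' fun _ => hfirst'')
  have h2 := tendsto_multiset (sha s' s'') (by
    intro w hw
    refine GG_tendsto w ?_ (fun _ => sha_head s' s'' h' h'' hfirst' hfirst'' w hw)
    intro x hx
    have := (sha_perm s' s'' w hw).mem_iff.1 hx
    rcases List.mem_append.1 this with h | h
    · exact hpos' x h
    · exact hpos'' x h)
  refine tendsto_nhds_unique h1 (h2.congr fun N => ?_)
  exact GG_symmetral N s' s''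
end

section
/- Depth-2 alternal multitangent identity: for all integers n_1, n_2 ≥ 2 and every z ∈ ℂ ∖ ℤ, Tan^{n_1,n_2}(z) = (1/2)·Te^{n_1,n_2}(z) − (1/2)·Te^{n_2,n_1}(z). -/
/-- The mould logarithm of `Te`:
`Ten^{t₁,…,t_m}(z) = ∑_{j=1}^m ((−1)^{j−1}/j) ∑ ∏_{i=1}^j Te^{tⁱ}(z)`, the inner sum running
over all decompositions of `(t₁,…,t_m)` into `j` consecutive nonempty blocks `t¹,…,tʲ`. -/
noncomputable def Ten (t : List ℕ) (z : ℂ) : ℂ :=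
  ∑ c : Composition t.length,
    ((-1 : ℂ)) ^ (c.length - 1) / (c.length : ℂ) *
      ((t.splitWrtComposition c).map (fun b => Te b z)).prod

/-- The alternal multitangent, `Tan = logmu(Te) ∘ (E−1)`:
`Tan^{s₁,…,s_r}(z) = ∑ (∏_{j=1}^k 1/ℓⱼ!) · Ten^{b₁,…,b_k}(z)`, the sum running over all
decompositions of `(s₁,…,s_r)` into `k ≥ 1` consecutive nonempty blocks, where `ℓⱼ` is the
length and `bⱼ` the sum of the `j`-th block. -/
noncomputable def Tan (s : List ℕ) (z : ℂ) : ℂ :=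
  ∑ c : Composition s.length,
    (((s.splitWrtComposition c).map (fun b => (1 : ℂ) / (b.length.factorial : ℂ))).prod) *
      Ten ((s.splitWrtComposition c).map List.sum) z

open Finset in
theorem aux_sum_comp_two (f : Composition 2 → ℂ) :
    ∑ c : Composition 2, f c = f (Composition.ones 2) + f (Composition.single 2 (by norm_num)) := by
  have hne : Composition.ones 2 ≠ Composition.single 2 (by norm_num) := by
    intro h
    have := congrArg Composition.length h
    simp at this
  have : (Finset.univ : Finset (Composition 2)) =
      {Composition.ones 2, Composition.single 2 (by norm_num)} := by
    symm
    apply Finset.eq_univ_of_card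
    rw [Finset.card_pair hne, composition_card]; norm_num
  rw [this, Finset.sum_pair hne]

theorem aux_sum_comp_one (f : Composition 1 → ℂ) :
    ∑ c : Composition 1, f c = f (Composition.single 1 (by norm_num)) := by
  have : (Finset.univ : Finset (Composition 1)) = {Composition.single 1 (by norm_num)} := by
    symm
    apply Finset.eq_univ_of_card
    rw [Finset.card_singleton, composition_card]; norm_num
  rw [this, Finset.sum_singleton]

theorem aux_Ten_one (a : ℕ) (z : ℂ) : Ten [a] z = Te [a] z := by
  unfold Ten
  refine (aux_sum_comp_one _).trans ?_
  have h : [a].splitWrtComposition (Composition.single 1 (by norm_num)) = [[a]] := rfl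
  have hl : (Composition.single 1 (by norm_num)).length = 1 := rfl
  erw [h, hl]
  simp

theorem aux_Ten_two (a b : ℕ) (z : ℂ) :
    Ten [a, b] z = Te [a, b] z - 1 / 2 * (Te [a] z * Te [b] z) := by
  unfold Ten
  refine (aux_sum_comp_two _).trans ?_
  have h : [a, b].splitWrtComposition (Composition.single 2 (by norm_num)) = [[a, b]] := rfl
  have hl : (Composition.single 2 (by norm_num)).length = 1 := rfl
  have h' : [a, b].splitWrtComposition (Composition.ones 2) = [[a], [b]] := rfl
  have hl' : (Composition.ones 2).length = 2 := rfl
  erw [h, hl, h', hl']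
  simp
  ring

theorem aux_Tan_two (a b : ℕ) (z : ℂ) :
    Tan [a, b] z = Ten [a, b] z + 1 / 2 * Ten [a + b] z := by
  unfold Tan
  refine (aux_sum_comp_two _).trans ?_
  have h : [a, b].splitWrtComposition (Composition.single 2 (by norm_num)) = [[a, b]] := rfl
  have h' : [a, b].splitWrtComposition (Composition.ones 2) = [[a], [b]] := rfl
  erw [h, h']
  simp

theorem aux_Te_one (a : ℕ) (z : ℂ) :
    Te [a] z = ∑' n : ℤ, ((n : ℂ) + z) ^ (-(a : ℤ)) := by
  unfold Te
  let e : ℤ ≃ {n : Fin [a].length → ℤ // StrictAnti n} :=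
    { toFun := fun n => ⟨fun _ => n, fun i j h => by
        have hi := i.2; have hj := j.2
        simp only [List.length_cons, List.length_nil] at hi hj
        have := Fin.lt_def.1 h
        omega⟩
      invFun := fun n => n.1 ⟨0, by simp⟩
      left_inv := fun n => rfl
      right_inv := fun n => by
        ext i
        have hi := i.2
        simp only [List.length_cons, List.length_nil] at hi
        have : i = ⟨0, by simp⟩ := Fin.ext (by simp)
        rw [this] }
  rw [← e.tsum_eq]
  refine tsum_congr fun n => ?_
  refine (Fin.prod_univ_one (M := ℂ) _).trans ?_
  rfl

theorem aux_Te_two (a b : ℕ) (z : ℂ) :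
    Te [a, b] z = ∑' p : {p : ℤ × ℤ | p.2 < p.1},
      ((p.1.1 : ℂ) + z) ^ (-(a : ℤ)) * ((p.1.2 : ℂ) + z) ^ (-(b : ℤ)) := by
  unfold Te
  let e : {p : ℤ × ℤ | p.2 < p.1} ≃ {n : Fin [a, b].length → ℤ // StrictAnti n} :=
    { toFun := fun p => ⟨(![p.1.1, p.1.2] : Fin 2 → ℤ), by
        have hp : p.1.2 < p.1.1 := p.2
        have : StrictAnti (![p.1.1, p.1.2] : Fin 2 → ℤ) := by
          intro i j h
          fin_cases i <;> fin_cases j <;> simp_all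
        exact this⟩
      invFun := fun n => ⟨(n.1 (0 : Fin 2), n.1 (1 : Fin 2)),
        n.2 (show (0 : Fin 2) < 1 by decide)⟩
      left_inv := fun p => rfl
      right_inv := fun n => by
        apply Subtype.ext
        show (![n.1 (0 : Fin 2), n.1 (1 : Fin 2)] : Fin 2 → ℤ) = n.1
        funext i
        fin_cases i <;> rfl }
  rw [← e.tsum_eq]
  refine tsum_congr fun p => ?_
  refine (Fin.prod_univ_two (M := ℂ) _).trans ?_
  rfl

theorem aux_summable_s13 (a : ℕ) (h : 2 ≤ a) (z : ℂ) :
    Summable fun n : ℤ => ‖((n : ℂ) + z) ^ (-(a : ℤ))‖ := by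
  rw [summable_norm_iff]
  have := EisensteinSeries.linear_right_summable z 1 (k := a) (by exact_mod_cast h)
  refine this.congr fun n => ?_
  rw [zpow_neg]
  simp [add_comm]

theorem aux_stuffle (a b : ℕ) (ha : 2 ≤ a) (hb : 2 ≤ b) (z : ℂ) (hz : ∀ n : ℤ, z ≠ (n : ℂ)) :
    Te [a] z * Te [b] z = Te [a, b] z + Te [b, a] z + Te [a + b] z := by
  let F : ℤ × ℤ → ℂ := fun p =>
    ((p.1 : ℂ) + z) ^ (-(a : ℤ)) * ((p.2 : ℂ) + z) ^ (-(b : ℤ))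
  have hF : Summable F := by
    have := summable_mul_of_summable_norm
      (f := fun n : ℤ => ((n : ℂ) + z) ^ (-(a : ℤ))) (g := fun n : ℤ => ((n : ℂ) + z) ^ (-(b : ℤ)))
      (aux_summable_s13 a ha z) (aux_summable_s13 b hb z)
    exact this
  have h1 : Te [a] z * Te [b] z = ∑' p, F p := by
    rw [aux_Te_one, aux_Te_one]
    exact tsum_mul_tsum_of_summable_norm
      (f := fun n : ℤ => ((n : ℂ) + z) ^ (-(a : ℤ))) (g := fun n : ℤ => ((n : ℂ) + z) ^ (-(b : ℤ)))
      (aux_summable_s13 a ha z) (aux_summable_s13 b hb z)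
  have h2 : Te [a, b] z = ∑' p : {p : ℤ × ℤ | p.2 < p.1}, F p := aux_Te_two a b z
  have h3 : Te [b, a] z = ∑' p : {p : ℤ × ℤ | p.1 < p.2}, F p := by
    rw [aux_Te_two]
    let e : {p : ℤ × ℤ | p.1 < p.2} ≃ {p : ℤ × ℤ | p.2 < p.1} :=
      { toFun := fun p => ⟨(p.1.2, p.1.1), p.2⟩
        invFun := fun p => ⟨(p.1.2, p.1.1), p.2⟩
        left_inv := fun p => rfl
        right_inv := fun p => rfl }
    rw [← e.tsum_eq]
    exact tsum_congr fun p => mul_comm _ _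
  have h4 : Te [a + b] z = ∑' p : {p : ℤ × ℤ | p.1 = p.2}, F p := by
    rw [aux_Te_one]
    let e : ℤ ≃ {p : ℤ × ℤ | p.1 = p.2} :=
      { toFun := fun n => ⟨(n, n), rfl⟩
        invFun := fun p => p.1.1
        left_inv := fun n => rfl
        right_inv := fun p => Subtype.ext (Prod.ext rfl p.2) }
    rw [← e.tsum_eq]
    refine tsum_congr fun n => ?_
    have hn : (n : ℂ) + z ≠ 0 := by
      intro h
      apply hz (-n)
      push_cast
      linear_combination h
    show _ = ((n : ℂ) + z) ^ (-(a : ℤ)) * ((n : ℂ) + z) ^ (-(b : ℤ))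
    rw [← zpow_add₀ hn]
    congr 1
    push_cast
    ring
  rw [h1, h2, h3, h4, tsum_subtype, tsum_subtype, tsum_subtype,
    ← (hF.indicator _).tsum_add (hF.indicator _),
    ← ((hF.indicator _).add (hF.indicator _)).tsum_add (hF.indicator _)]
  refine tsum_congr fun p => ?_
  rcases lt_trichotomy p.1 p.2 with h | h | h
  · simp [Set.indicator, h, h.ne, h.not_gt]
  · simp [Set.indicator, h]
  · simp [Set.indicator, h, h.ne', h.not_gt]

/-- Depth-2 alternal multitangent identity. -/
theorem Tan_depth_two (n₁ n₂ : ℕ) (h₁ : 2 ≤ n₁) (h₂ : 2 ≤ n₂)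
    (z : ℂ) (hz : ∀ n : ℤ, z ≠ (n : ℂ)) :
    Tan [n₁, n₂] z = (1 / 2 : ℂ) * Te [n₁, n₂] z - (1 / 2 : ℂ) * Te [n₂, n₁] z := by
  rw [aux_Tan_two, aux_Ten_two, aux_Ten_one, aux_stuffle n₁ n₂ h₁ h₂ z hz]
  ring
end
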